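/- arXiv:2112.14727 — 12 statements merged into one kernel-verified Lean document; each statement's English description precedes it below -/
import Mathlib

section
/- Fix c ∈ ℝ and d ≥ 1. A function f : ℝ^d → ℝ is strongly MTP2 if and only if for all x, y ∈ ℝ^d and all real s, t with s ≥ c and t ≥ c one has f(x − s·𝟙)·f(y − t·𝟙) ≤ f(x ∨ y − max(s,t)·𝟙)·f(x ∧ y − min(s,t)·𝟙). -/
/-- A function `f : ℝ^n → ℝ` is strongly MTP₂ if
`f(x ∨ (y − α·𝟙)) · f((x + α·𝟙) ∧ y) ≥ f(x) · f(y)` for all `x, y` and all `α ≥ 0`. -/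
def StronglyMTP2 {n : ℕ} (f : (Fin n → ℝ) → ℝ) : Prop :=
  ∀ (x y : Fin n → ℝ) (α : ℝ), 0 ≤ α →
    f x * f y ≤ f (x ⊔ (y - α • (1 : Fin n → ℝ))) * f ((x + α • (1 : Fin n → ℝ)) ⊓ y)

lemma sup_sub_shift {n : ℕ} (x y : Fin n → ℝ) (s t : ℝ) :
    (x ⊔ y) - s • (1 : Fin n → ℝ) =
      (x - s • (1 : Fin n → ℝ)) ⊔ (y - t • (1 : Fin n → ℝ) - (s - t) • (1 : Fin n → ℝ)) := by
  rw [sub_sub, ← add_smul, add_sub_cancel, sup_sub]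

lemma inf_sub_shift {n : ℕ} (x y : Fin n → ℝ) (s t : ℝ) :
    (x ⊓ y) - t • (1 : Fin n → ℝ) =
      (x - s • (1 : Fin n → ℝ) + (s - t) • (1 : Fin n → ℝ)) ⊓ (y - t • (1 : Fin n → ℝ)) := by
  rw [inf_sub, sub_smul, sub_add_sub_cancel]

lemma StronglyMTP2.mul_le_of_le {n : ℕ} {f : (Fin n → ℝ) → ℝ} (hf : StronglyMTP2 f)
    (x y : Fin n → ℝ) {s t : ℝ} (hts : t ≤ s) :
    f (x - s • (1 : Fin n → ℝ)) * f (y - t • (1 : Fin n → ℝ)) ≤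
      f ((x ⊔ y) - s • (1 : Fin n → ℝ)) * f ((x ⊓ y) - t • (1 : Fin n → ℝ)) := by
  rw [sup_sub_shift x y s t, inf_sub_shift x y s t]
  exact hf _ _ _ (sub_nonneg.mpr hts)

/-- Fix `c ∈ ℝ` and `d ≥ 1`. A function `f : ℝ^d → ℝ` is strongly MTP₂
if and only if for all `x, y ∈ ℝ^d` and all real `s, t ≥ c`,
`f(x − s·𝟙)·f(y − t·𝟙) ≤ f(x ∨ y − max(s,t)·𝟙)·f(x ∧ y − min(s,t)·𝟙)`. -/
theorem stronglyMTP2_iff_shifted (c : ℝ) (d : ℕ) (hd : 1 ≤ d)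
    (f : (Fin d → ℝ) → ℝ) :
    StronglyMTP2 f ↔
      ∀ (x y : Fin d → ℝ) (s t : ℝ), c ≤ s → c ≤ t →
        f (x - s • (1 : Fin d → ℝ)) * f (y - t • (1 : Fin d → ℝ)) ≤
          f ((x ⊔ y) - (max s t) • (1 : Fin d → ℝ)) *
            f ((x ⊓ y) - (min s t) • (1 : Fin d → ℝ)) := by
  refine ⟨fun hf x y s t _ _ => ?_, fun h x y α hα => ?_⟩
  · rcases le_total t s with hts | hst
    · rw [max_eq_left hts, min_eq_right hts]
      exact hf.mul_le_of_le x y hts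
    · rw [max_eq_right hst, min_eq_left hst, mul_comm (f (x - _)), sup_comm, inf_comm]
      exact hf.mul_le_of_le y x hst
  · have hc : c ≤ c + α := le_add_of_nonneg_right hα
    have key := h (x + (c + α) • 1) (y + c • 1) (c + α) c hc le_rfl
    rwa [max_eq_left hc, min_eq_right hc, sup_sub_shift _ _ _ c, inf_sub_shift _ _ (c + α),
      add_sub_cancel_right, add_sub_cancel_right, add_sub_cancel_left] at key
end

section
/- Let d ≥ 1, c ∈ ℝ, let f₀ : ℝ → ℝ be nonnegative with f₀(x) > 0 if and only if x ≥ c, and let f_X : ℝ^d → ℝ be nonnegative. Define f : ℝ × ℝ^d → ℝ by f(z₀, z) = f₀(z₀)·f_X(z − z₀·𝟙). Then f is MTP2 (as a function on ℝ^{1+d} with the componentwise lattice operations) if and only if f_X is strongly MTP2. -/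
/-- MTP₂ for functions on `ℝ × ℝ^d` (identified with `ℝ^{1+d}` with the componentwise
lattice operations). -/
def MTP2Pair {d : ℕ} (f : ℝ × (Fin d → ℝ) → ℝ) : Prop :=
  ∀ x y : ℝ × (Fin d → ℝ), f x * f y ≤ f (x ⊔ y) * f (x ⊓ y)

lemma sup_sub_smul_one {d : ℕ} (z w : Fin d → ℝ) (s t : ℝ) :
    z ⊔ w - s • (1 : Fin d → ℝ) =
      (z - s • (1 : Fin d → ℝ)) ⊔ ((w - t • (1 : Fin d → ℝ)) - (s - t) • (1 : Fin d → ℝ)) := by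
  rw [sup_sub]
  congr 1
  module

lemma inf_sub_smul_one {d : ℕ} (z w : Fin d → ℝ) (s t : ℝ) :
    z ⊓ w - t • (1 : Fin d → ℝ) =
      ((z - s • (1 : Fin d → ℝ)) + (s - t) • (1 : Fin d → ℝ)) ⊓ (w - t • (1 : Fin d → ℝ)) := by
  rw [inf_sub]
  congr 1
  module

/-- Let `d ≥ 1`, `c ∈ ℝ`, `f₀ : ℝ → ℝ` nonnegative with `f₀(x) > 0 ↔ x ≥ c`,
and `f_X : ℝ^d → ℝ` nonnegative. Define `f(z₀, z) = f₀(z₀)·f_X(z − z₀·𝟙)`. Then `f` is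
MTP₂ if and only if `f_X` is strongly MTP₂. -/
theorem mtp2_shiftMixture_iff_stronglyMTP2 (d : ℕ) (hd : 1 ≤ d) (c : ℝ)
    (f₀ : ℝ → ℝ) (fX : (Fin d → ℝ) → ℝ)
    (hf₀nn : ∀ x, 0 ≤ f₀ x) (hf₀supp : ∀ x, 0 < f₀ x ↔ c ≤ x)
    (hfXnn : ∀ w, 0 ≤ fX w) :
    MTP2Pair (fun z : ℝ × (Fin d → ℝ) => f₀ z.1 * fX (z.2 - z.1 • (1 : Fin d → ℝ))) ↔
      StronglyMTP2 fX := by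
  constructor
  · intro h x y α hα
    have hpos : 0 < f₀ (c + α) * f₀ c :=
      mul_pos ((hf₀supp _).2 (by linarith)) ((hf₀supp _).2 le_rfl)
    have key := h (c + α, x + (c + α) • 1) (c, y + c • 1)
    have hle : c ≤ c + α := by linarith
    simp only [Prod.fst_sup, Prod.snd_sup, Prod.fst_inf, Prod.snd_inf, sup_of_le_left hle,
      inf_of_le_right hle] at key
    rw [sup_sub_smul_one _ _ (c + α) c, inf_sub_smul_one _ _ (c + α) c] at key
    simp only [add_sub_cancel_right, add_sub_cancel_left] at key
    refine le_of_mul_le_mul_left ?_ hpos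
    linarith
  · intro h
    have ordered : ∀ x y : ℝ × (Fin d → ℝ), y.1 ≤ x.1 →
        f₀ x.1 * fX (x.2 - x.1 • 1) * (f₀ y.1 * fX (y.2 - y.1 • 1)) ≤
          f₀ (x ⊔ y).1 * fX ((x ⊔ y).2 - (x ⊔ y).1 • 1) *
            (f₀ (x ⊓ y).1 * fX ((x ⊓ y).2 - (x ⊓ y).1 • 1)) := by
      intro x y hle
      simp only [Prod.fst_sup, Prod.snd_sup, Prod.fst_inf, Prod.snd_inf, sup_of_le_left hle,
        inf_of_le_right hle]
      rw [sup_sub_smul_one _ _ x.1 y.1, inf_sub_smul_one _ _ x.1 y.1]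
      have key := mul_le_mul_of_nonneg_left
        (h (x.2 - x.1 • 1) (y.2 - y.1 • 1) (x.1 - y.1) (sub_nonneg.2 hle))
        (mul_nonneg (hf₀nn x.1) (hf₀nn y.1))
      linarith
    intro x y
    rcases le_total y.1 x.1 with hle | hle
    · exact ordered x y hle
    · have key := ordered y x hle
      rw [sup_comm, inf_comm, mul_comm] at key
      exact key
end

section
/- Let d ≥ 1, c ∈ ℝ, let f₀ : ℝ → ℝ be nonnegative with f₀(x) > 0 if and only if x ≥ c, and let f_X : ℝ^d → ℝ be nonnegative with f_X(w) > 0 for at least one w ∈ ℝ^d. Define f : ℝ × ℝ^d → ℝ by f(z₀, z) = f₀(z₀)·f_X(z − z₀·𝟙). Then f is strongly MTP2 (as a function on ℝ^{1+d}) if and only if both f₀ (as a function on ℝ) and f_X are strongly MTP2. -/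
/-- Strong MTP₂ for univariate functions (for `n = 1` the all-ones vector is the scalar `1`). -/
def StronglyMTP2One (f : ℝ → ℝ) : Prop :=
  ∀ (x y α : ℝ), 0 ≤ α → f x * f y ≤ f (x ⊔ (y - α)) * f ((x + α) ⊓ y)

/-- Strong MTP₂ for functions on `ℝ × ℝ^d` (identified with `ℝ^{1+d}` with the componentwise
lattice operations; the all-ones vector of `ℝ^{1+d}` is `(1, 𝟙)`). -/
def StronglyMTP2Pair {d : ℕ} (f : ℝ × (Fin d → ℝ) → ℝ) : Prop :=
  ∀ (x y : ℝ × (Fin d → ℝ)) (α : ℝ), 0 ≤ α →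
    f x * f y ≤ f (x ⊔ (y - α • (1 : ℝ × (Fin d → ℝ)))) *
      f ((x + α • (1 : ℝ × (Fin d → ℝ))) ⊓ y)

/-- Along the coordinates `(z₀, z - z₀ • 𝟙)`, the strong MTP₂ inequality of a shift mixture is
that of its two factors, with the shift parameter absorbed in the second one. -/
theorem stronglyMTP2Pair_shiftMixture_iff_forall {d : ℕ} (f₀ : ℝ → ℝ) (fX : (Fin d → ℝ) → ℝ) :
    StronglyMTP2Pair (fun z : ℝ × (Fin d → ℝ) => f₀ z.1 * fX (z.2 - z.1 • (1 : Fin d → ℝ))) ↔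
      ∀ (a b α : ℝ) (u v : Fin d → ℝ), 0 ≤ α →
        (f₀ a * fX u) * (f₀ b * fX v) ≤
          (f₀ (a ⊔ (b - α)) * fX ((u + a • (1 : Fin d → ℝ)) ⊔ (v + (b - α) • (1 : Fin d → ℝ)) -
            (a ⊔ (b - α)) • (1 : Fin d → ℝ))) *
          (f₀ ((a + α) ⊓ b) * fX ((u + (a + α) • (1 : Fin d → ℝ)) ⊓ (v + b • (1 : Fin d → ℝ)) -
            ((a + α) ⊓ b) • (1 : Fin d → ℝ))) := by
  constructor
  · intro h a b α u v hα
    have := h (a, u + a • 1) (b, v + b • 1) α hα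
    simpa [add_smul, sub_smul, add_assoc, add_sub_assoc] using this
  · rintro h ⟨a, x⟩ ⟨b, y⟩ α hα
    have := h a b α (x - a • 1) (y - b • 1) hα
    simpa [add_smul, sub_smul, ← add_assoc, ← add_sub_assoc] using this

theorem sup_shift_sub_of_le {d : ℕ} {a b : ℝ} (h : b ≤ a) (u v : Fin d → ℝ) :
    (u + a • (1 : Fin d → ℝ)) ⊔ (v + b • (1 : Fin d → ℝ)) - (a ⊔ b) • (1 : Fin d → ℝ) =
      u ⊔ (v - (a - b) • (1 : Fin d → ℝ)) := by
  ext i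
  simp only [sup_eq_left.2 h, Pi.sub_apply, Pi.sup_apply, Pi.add_apply, Pi.smul_apply,
    Pi.one_apply, smul_eq_mul, mul_one, ← max_sub_sub_right _ _ a]
  congr 1 <;> ring

theorem inf_shift_sub_of_le {d : ℕ} {a b : ℝ} (h : b ≤ a) (u v : Fin d → ℝ) :
    (u + a • (1 : Fin d → ℝ)) ⊓ (v + b • (1 : Fin d → ℝ)) - (a ⊓ b) • (1 : Fin d → ℝ) =
      (u + (a - b) • (1 : Fin d → ℝ)) ⊓ v := by
  ext i
  simp only [inf_eq_right.2 h, Pi.sub_apply, Pi.inf_apply, Pi.add_apply, Pi.smul_apply,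
    Pi.one_apply, smul_eq_mul, mul_one, ← min_sub_sub_right _ _ b]
  congr 1 <;> ring

/-- Let `d ≥ 1`, `c ∈ ℝ`, `f₀ : ℝ → ℝ` nonnegative with `f₀(x) > 0 ↔ x ≥ c`,
and `f_X : ℝ^d → ℝ` nonnegative with `f_X(w) > 0` for at least one `w`. Define
`f(z₀, z) = f₀(z₀)·f_X(z − z₀·𝟙)`. Then `f` is strongly MTP₂ if and only if both `f₀`
and `f_X` are strongly MTP₂. -/
theorem stronglyMTP2_shiftMixture_iff (d : ℕ) (hd : 1 ≤ d) (c : ℝ)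
    (f₀ : ℝ → ℝ) (fX : (Fin d → ℝ) → ℝ)
    (hf₀nn : ∀ x, 0 ≤ f₀ x) (hf₀supp : ∀ x, 0 < f₀ x ↔ c ≤ x)
    (hfXnn : ∀ w, 0 ≤ fX w) (hfXpos : ∃ w, 0 < fX w) :
    StronglyMTP2Pair (fun z : ℝ × (Fin d → ℝ) => f₀ z.1 * fX (z.2 - z.1 • (1 : Fin d → ℝ))) ↔
      (StronglyMTP2One f₀ ∧ StronglyMTP2 fX) := by
  rw [stronglyMTP2Pair_shiftMixture_iff_forall]
  constructor
  · intro h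
    refine ⟨fun a b α hα => ?_, fun u v α hα => ?_⟩
    · obtain ⟨w, hw⟩ := hfXpos
      have key := h a b α w w hα
      have hsup : (w + a • (1 : Fin d → ℝ)) ⊔ (w + (b - α) • (1 : Fin d → ℝ)) -
          (a ⊔ (b - α)) • (1 : Fin d → ℝ) = w := by
        ext i
        simp [max_add_add_left]
      have hinf : (w + (a + α) • (1 : Fin d → ℝ)) ⊓ (w + b • (1 : Fin d → ℝ)) -
          ((a + α) ⊓ b) • (1 : Fin d → ℝ) = w := by
        ext i
        simp [min_add_add_left]
      rw [hsup, hinf, mul_mul_mul_comm, mul_mul_mul_comm (f₀ (a ⊔ (b - α)))] at key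
      exact le_of_mul_le_mul_right key (mul_pos hw hw)
    · have key := h c c α u v hα
      have hc : 0 < f₀ c := (hf₀supp c).2 le_rfl
      rw [sup_shift_sub_of_le (by linarith), inf_shift_sub_of_le (by linarith),
        sup_eq_left.2 (by linarith), inf_eq_right.2 (by linarith), sub_sub_cancel,
        add_sub_cancel_left, mul_mul_mul_comm, mul_mul_mul_comm (f₀ c) _ (f₀ c)] at key
      exact le_of_mul_le_mul_left key (mul_pos hc hc)
  · rintro ⟨h₀, hX⟩ a b α u v hα
    rw [mul_mul_mul_comm, mul_mul_mul_comm (f₀ (a ⊔ (b - α)))]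
    refine mul_le_mul (h₀ a b α hα) ?_ (mul_nonneg (hfXnn _) (hfXnn _))
      (mul_nonneg (hf₀nn _) (hf₀nn _))
    rcases le_total (b - α) a with hab | hab
    · rw [sup_shift_sub_of_le hab, inf_shift_sub_of_le (by linarith),
        show a + α - b = a - (b - α) by ring]
      exact hX u v _ (sub_nonneg.2 hab)
    · rw [sup_comm (u + _), sup_comm a, inf_comm (u + _), inf_comm (a + α),
        sup_shift_sub_of_le hab, inf_shift_sub_of_le (by linarith),
        show b - (a + α) = b - α - a by ring, mul_comm (fX u)]
      exact hX v u _ (sub_nonneg.2 hab)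
end

section
/- A Lebesgue-measurable nonnegative function f : ℝ → ℝ is strongly MTP2 (as a univariate function) if and only if f is log-concave. -/
/-- A function `h : ℝ → ℝ` is log-concave if
`h((1−λ)x + λy) ≥ h(x)^{1−λ}·h(y)^{λ}` for all `x, y` and `λ ∈ [0,1]`
(real powers). -/
def LogConcaveFun (h : ℝ → ℝ) : Prop :=
  ∀ (x y l : ℝ), 0 ≤ l → l ≤ 1 →
    h x ^ (1 - l) * h y ^ l ≤ h ((1 - l) * x + l * y)

open MeasureTheory Set

/-- In a conservative system, a measurable real function cannot decrease by a fixed positive amount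
at every step. -/
theorem MeasureTheory.Conservative.not_forall_le_sub {X : Type*} [MeasurableSpace X]
    {μ : Measure X} [NeZero μ] {T : X → X} (hT : Conservative T μ) {ψ : X → ℝ}
    (hψ : Measurable ψ) {c : ℝ} (hc : 0 < c) : ¬ ∀ x, ψ (T x) ≤ ψ x - c := by
  intro h
  have hiter : ∀ (m : ℕ) (x : X), ψ (T^[m] x) ≤ ψ x - m * c := by
    intro m
    induction m with
    | zero => simp
    | succ m ih =>
      intro x
      have := ih (T x)
      have := h x
      rw [Function.iterate_succ_apply]
      push_cast
      linarith
  have hmeas : ∀ k : ℤ, MeasurableSet (ψ ⁻¹' Ico (k * c) ((k + 1) * c)) := fun k =>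
    hψ measurableSet_Ico
  have hcover : ⋃ k : ℤ, ψ ⁻¹' Ico (k * c) ((k + 1) * c) = univ := by
    refine eq_univ_of_forall fun x => mem_iUnion.2 ⟨⌊ψ x / c⌋, ?_, ?_⟩
    · exact (le_div_iff₀ hc).1 (Int.floor_le _)
    · exact (div_lt_iff₀ hc).1 (Int.lt_floor_add_one _)
  obtain ⟨k, hk⟩ : ∃ k : ℤ, μ (ψ ⁻¹' Ico (k * c) ((k + 1) * c)) ≠ 0 := by
    by_contra! hzero
    have := measure_iUnion_null_iff.2 hzero
    rw [hcover] at this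
    exact NeZero.ne μ (Measure.measure_univ_eq_zero.1 this)
  obtain ⟨x, hx, m, hm, hmx⟩ := hT.exists_mem_iterate_mem' (hmeas k) hk
  have hm1 : (1 : ℝ) ≤ m := by exact_mod_cast Nat.one_le_iff_ne_zero.2 hm
  have := hiter m x
  have := hx.2
  have := hmx.1
  nlinarith

/-- A measurable Wright-concave function on `[0, 1]` vanishing at the endpoints is nonnegative. -/
theorem nonneg_of_measurable_of_wright_concave {φ : ℝ → ℝ} (hφ : Measurable φ)
    (h0 : φ 0 = 0) (h1 : φ 1 = 0)
    (hW : ∀ x y α, 0 ≤ x → y ≤ 1 → 0 ≤ α → x + α ≤ y → φ x + φ y ≤ φ (x + α) + φ (y - α))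
    {t : ℝ} (ht0 : 0 ≤ t) (ht1 : t ≤ 1) : 0 ≤ φ t := by
  by_contra! hneg
  have hrot : Conservative (· + (t : UnitAddCircle)) (volume : Measure UnitAddCircle) :=
    (measurePreserving_add_right volume _).conservative
  have hψ : Measurable fun z : UnitAddCircle => φ (AddCircle.equivIco 1 0 z) :=
    hφ.comp (measurable_subtype_coe.comp (AddCircle.measurableEquivIco 1 0).measurable)
  refine hrot.not_forall_le_sub hψ (neg_pos.2 hneg) fun z => ?_
  obtain ⟨u, hu⟩ : ∃ u : ℝ, u = AddCircle.equivIco (1 : ℝ) 0 z := ⟨_, rfl⟩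
  have hz : z = (u : UnitAddCircle) := by rw [hu, AddCircle.coe_equivIco]
  have hu0 : 0 ≤ u := hu ▸ (AddCircle.equivIco (1 : ℝ) 0 z).2.1
  have hu1 : u < 1 := by
    linarith [(AddCircle.equivIco (1 : ℝ) 0 z).2.2]
  rw [← hu, hz]
  rcases lt_or_ge (u + t) 1 with h | h
  · rw [← AddCircle.coe_add, AddCircle.equivIco_coe_of_mem ⟨by linarith, by linarith⟩]
    have := hW 0 (u + t) u le_rfl h.le hu0 (by linarith)
    rw [h0, zero_add, zero_add, add_sub_cancel_left] at this
    linarith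
  · have hwrap : (u : UnitAddCircle) + (t : UnitAddCircle) = ((u + t - 1 : ℝ) : UnitAddCircle) := by
      rw [AddCircle.coe_sub, AddCircle.coe_add, AddCircle.coe_period, sub_zero]
    rw [hwrap, AddCircle.equivIco_coe_of_mem ⟨by linarith, by linarith⟩]
    have := hW (u + t - 1) 1 (1 - t) (by linarith) le_rfl (by linarith) (by linarith)
    rw [h1, show u + t - 1 + (1 - t) = u by ring, show 1 - (1 - t) = t by ring] at this
    linarith

theorem StronglyMTP2One.mul_le_mul {f : ℝ → ℝ} (hf : StronglyMTP2One f) {x y α : ℝ}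
    (hα : 0 ≤ α) (h : x + α ≤ y) : f x * f y ≤ f (x + α) * f (y - α) := by
  have := hf x y α hα
  rwa [sup_of_le_right (by linarith), inf_of_le_left h, mul_comm (f (y - α))] at this

theorem StronglyMTP2One.pos_of_mem_Icc {f : ℝ → ℝ} (hf : StronglyMTP2One f) (hnn : ∀ x, 0 ≤ f x)
    {a b c : ℝ} (ha : 0 < f a) (hb : 0 < f b) (hc : c ∈ Icc a b) : 0 < f c := by
  have := hf.mul_le_mul (x := a) (y := b) (sub_nonneg.2 hc.1) (by linarith [hc.2])
  rw [add_sub_cancel] at this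
  exact pos_of_mul_pos_left ((mul_pos ha hb).trans_le this) (hnn _)

theorem StronglyMTP2One.rpow_mul_rpow_le {f : ℝ → ℝ} (hf : StronglyMTP2One f)
    (hmeas : Measurable f) (hnn : ∀ x, 0 ≤ f x) {a b l : ℝ} (hab : a ≤ b)
    (ha : 0 < f a) (hb : 0 < f b) (hl0 : 0 ≤ l) (hl1 : l ≤ 1) :
    f a ^ (1 - l) * f b ^ l ≤ f ((1 - l) * a + l * b) := by
  have hpos : ∀ t, 0 ≤ t → t ≤ 1 → 0 < f ((1 - t) * a + t * b) := fun t h0 h1 =>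
    hf.pos_of_mem_Icc hnn ha hb ⟨by nlinarith, by nlinarith⟩
  have key := nonneg_of_measurable_of_wright_concave
    (φ := fun t => Real.log (f ((1 - t) * a + t * b))
      - ((1 - t) * Real.log (f a) + t * Real.log (f b)))
    (by fun_prop) (by simp) (by simp) (fun x y α hx hy hα hxy => ?_) hl0 hl1
  · rw [Real.rpow_def_of_pos ha, Real.rpow_def_of_pos hb, ← Real.exp_add,
      ← Real.le_log_iff_exp_le (hpos l hl0 hl1)]
    linarith
  · have hprod := hf.mul_le_mul (x := (1 - x) * a + x * b) (y := (1 - y) * a + y * b)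
      (α := α * (b - a)) (mul_nonneg hα (sub_nonneg.2 hab)) (by nlinarith)
    rw [show (1 - x) * a + x * b + α * (b - a) = (1 - (x + α)) * a + (x + α) * b by ring,
      show (1 - y) * a + y * b - α * (b - a) = (1 - (y - α)) * a + (y - α) * b by ring] at hprod
    have hx' := hpos x hx (by linarith)
    have hy' := hpos y (by linarith) hy
    have hxα := hpos (x + α) (by linarith) (by linarith)
    have hyα := hpos (y - α) (by linarith) (by linarith)
    have hlog := Real.log_le_log (mul_pos hx' hy') hprod
    rw [Real.log_mul hx'.ne' hy'.ne', Real.log_mul hxα.ne' hyα.ne'] at hlog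
    linarith

theorem StronglyMTP2One.logConcaveFun {f : ℝ → ℝ} (hf : StronglyMTP2One f)
    (hmeas : Measurable f) (hnn : ∀ x, 0 ≤ f x) : LogConcaveFun f := by
  intro x y l hl0 hl1
  rcases hl0.eq_or_lt with rfl | hl0'
  · simp
  rcases hl1.eq_or_lt with rfl | hl1'
  · simp
  rcases (hnn x).eq_or_lt with hx | hx
  · rw [← hx, Real.zero_rpow (by linarith), zero_mul]
    exact hnn _
  rcases (hnn y).eq_or_lt with hy | hy
  · rw [← hy, Real.zero_rpow hl0'.ne', mul_zero]
    exact hnn _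
  rcases le_total x y with hxy | hxy
  · exact hf.rpow_mul_rpow_le hmeas hnn hxy hx hy hl0 hl1
  · have := hf.rpow_mul_rpow_le hmeas hnn hxy hy hx (sub_nonneg.2 hl1) (by linarith : 1 - l ≤ 1)
    rwa [sub_sub_cancel, mul_comm, add_comm] at this

theorem LogConcaveFun.stronglyMTP2One {f : ℝ → ℝ} (hf : LogConcaveFun f)
    (hnn : ∀ x, 0 ≤ f x) : StronglyMTP2One f := by
  intro x y α hα
  rcases le_total y (x + α) with h | h
  · rw [sup_of_le_left (by linarith), inf_of_le_right h]
  rw [sup_of_le_right (by linarith), inf_of_le_left h]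
  rcases (hnn x).eq_or_lt with hx | hx
  · rw [← hx, zero_mul]
    exact mul_nonneg (hnn _) (hnn _)
  rcases (hnn y).eq_or_lt with hy | hy
  · rw [← hy, mul_zero]
    exact mul_nonneg (hnn _) (hnn _)
  rcases hα.eq_or_lt with rfl | hα'
  · rw [sub_zero, add_zero, mul_comm]
  have hxy : 0 < y - x := by linarith
  obtain ⟨l, hl⟩ : ∃ l, l = α / (y - x) := ⟨_, rfl⟩
  have hlα : l * (y - x) = α := by rw [hl, div_mul_cancel₀ _ hxy.ne']
  have hl0 : 0 ≤ l := hl ▸ div_nonneg hα hxy.le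
  have hl1 : l ≤ 1 := hl ▸ (div_le_one hxy).2 (by linarith)
  have h₁ := hf x y l hl0 hl1
  have h₂ := hf x y (1 - l) (by linarith) (by linarith)
  rw [show (1 - l) * x + l * y = x + α by linarith] at h₁
  rw [sub_sub_cancel, show l * x + (1 - l) * y = y - α by linarith] at h₂
  calc f x * f y
      = (f x ^ l * f y ^ (1 - l)) * (f x ^ (1 - l) * f y ^ l) := by
        rw [mul_mul_mul_comm, ← Real.rpow_add hx, ← Real.rpow_add hy]
        simp
    _ ≤ f (y - α) * f (x + α) :=
        _root_.mul_le_mul h₂ h₁ (by positivity) (hnn _)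

/-- A Lebesgue-measurable nonnegative function `f : ℝ → ℝ` is strongly MTP₂
if and only if it is log-concave. -/
theorem stronglyMTP2One_iff_logConcave (f : ℝ → ℝ)
    (hmeas : Measurable f) (hnn : ∀ x, 0 ≤ f x) :
    StronglyMTP2One f ↔ LogConcaveFun f :=
  ⟨fun h => h.logConcaveFun hmeas hnn, fun h => h.stronglyMTP2One hnn⟩
end

section
/- Let f₁, …, f_d : ℝ → ℝ be nonnegative functions, each positive at some point of ℝ. Then the product function f : ℝ^d → ℝ, f(x) = ∏_{i=1}^d f_i(x_i), is strongly MTP2 if and only if each f_i is strongly MTP2 (as a univariate function). -/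
theorem prod_apply_update {ι M : Type*} [Fintype ι] [DecidableEq ι] [CommMonoid M] {α : ι → Type*}
    (g : (i : ι) → α i → M) (z : (i : ι) → α i) (i : ι) (a : α i) :
    ∏ j, g j (Function.update z i a j) = g i a * ∏ j ∈ Finset.univ.erase i, g j (z j) := by
  rw [← Finset.mul_prod_erase _ _ (Finset.mem_univ i), Function.update_self]
  congr 1
  refine Finset.prod_congr rfl fun j hj => ?_
  rw [Function.update_of_ne (Finset.ne_of_mem_erase hj)]

theorem update_sup_update_sub {n : ℕ} (z : Fin n → ℝ) (i : Fin n) (a b : ℝ) {α : ℝ} (hα : 0 ≤ α) :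
    Function.update z i a ⊔ (Function.update z i b - α • (1 : Fin n → ℝ)) =
      Function.update z i (a ⊔ (b - α)) := by
  ext j
  by_cases h : j = i
  · subst h
    simp
  · simp [h, hα]

theorem update_add_inf_update {n : ℕ} (z : Fin n → ℝ) (i : Fin n) (a b : ℝ) {α : ℝ} (hα : 0 ≤ α) :
    (Function.update z i a + α • (1 : Fin n → ℝ)) ⊓ Function.update z i b =
      Function.update z i ((a + α) ⊓ b) := by
  ext j
  by_cases h : j = i
  · subst h
    simp
  · simp [h, hα]

/-- Let `f₁, …, f_d : ℝ → ℝ` be nonnegative functions, each positive at some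
point. Then the product function `f(x) = ∏ᵢ fᵢ(xᵢ)` is strongly MTP₂ if and only if each
`fᵢ` is strongly MTP₂. -/
theorem stronglyMTP2_product_iff (d : ℕ) (fs : Fin d → ℝ → ℝ)
    (hnn : ∀ i x, 0 ≤ fs i x) (hpos : ∀ i, ∃ x, 0 < fs i x) :
    StronglyMTP2 (fun x : Fin d → ℝ => ∏ i, fs i (x i)) ↔
      ∀ i, StronglyMTP2One (fs i) := by
  constructor
  · intro h i a b α hα
    choose z hz using hpos
    have key := h (Function.update z i a) (Function.update z i b) α hα
    rw [update_sup_update_sub z i a b hα, update_add_inf_update z i a b hα] at key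
    simp only [prod_apply_update] at key
    have hP : 0 < ∏ j ∈ Finset.univ.erase i, fs j (z j) := Finset.prod_pos fun j _ => hz j
    rw [mul_mul_mul_comm, mul_mul_mul_comm (fs i (a ⊔ (b - α)))] at key
    exact le_of_mul_le_mul_right key (mul_pos hP hP)
  · intro h x y α hα
    simp only [← Finset.prod_mul_distrib]
    refine Finset.prod_le_prod (fun i _ => mul_nonneg (hnn i _) (hnn i _)) fun i _ => ?_
    simpa using h i (x i) (y i) α hα
end

section
/- Let d ≥ 1 and let f : ℝ^d × ℝ → [0,∞] be a measurable function that is strongly MTP2 as a function on ℝ^{d+1} (with the defining inequality read in the extended nonnegative reals). Then the marginal g : ℝ^d → [0,∞], g(x) = ∫ f(x,t) dt (Lebesgue integral over t ∈ ℝ, with values in [0,∞]), is strongly MTP2. -/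
open MeasureTheory
open scoped ENNReal

/-- Strong MTP₂ for `[0,∞]`-valued functions on `ℝ^d × ℝ` (identified with `ℝ^{d+1}` with
the componentwise lattice operations; the all-ones vector of `ℝ^{d+1}` is `(𝟙, 1)`).
The defining inequality is read in the extended nonnegative reals. -/
def StronglyMTP2PairENN {d : ℕ} (f : (Fin d → ℝ) × ℝ → ℝ≥0∞) : Prop :=
  ∀ (x y : (Fin d → ℝ) × ℝ) (α : ℝ), 0 ≤ α →
    f x * f y ≤ f (x ⊔ (y - α • (1 : (Fin d → ℝ) × ℝ))) *
      f ((x + α • (1 : (Fin d → ℝ) × ℝ)) ⊓ y)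

/-- Strong MTP₂ for `[0,∞]`-valued functions on `ℝ^d`. -/
def StronglyMTP2ENN {d : ℕ} (g : (Fin d → ℝ) → ℝ≥0∞) : Prop :=
  ∀ (x y : Fin d → ℝ) (α : ℝ), 0 ≤ α →
    g x * g y ≤ g (x ⊔ (y - α • (1 : Fin d → ℝ))) * g ((x + α • (1 : Fin d → ℝ)) ⊓ y)

/-- If `u, v ≤ w` and `u * v ≤ w * z` in `[0,∞]`, then `u + v ≤ w + z`. -/
theorem ENNReal.add_le_add_of_mul_le_mul_of_le {u v w z : ℝ≥0∞} (hu : u ≤ w) (hv : v ≤ w)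
    (h : u * v ≤ w * z) : u + v ≤ w + z := by
  rcases eq_or_ne w ∞ with rfl | hw
  · simp
  rcases eq_or_ne z ∞ with rfl | hz
  · simp
  lift w to NNReal using hw
  lift z to NNReal using hz
  lift u to NNReal using ne_top_of_le_ne_top ENNReal.coe_ne_top hu
  lift v to NNReal using ne_top_of_le_ne_top ENNReal.coe_ne_top hv
  norm_cast at *
  rcases eq_or_ne w 0 with rfl | hw
  · simp_all
  have hw' : (0 : ℝ) < w := by positivity
  rw [← NNReal.coe_le_coe] at *
  push_cast at *
  nlinarith [mul_nonneg (sub_nonneg.2 hu) (sub_nonneg.2 hv)]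

/-- The Ahlswede–Daykin four functions inequality for integrals over a linear order. -/
theorem lintegral_mul_lintegral_le_of_sup_inf {T : Type*} [LinearOrder T] [MeasurableSpace T]
    (μ : Measure T) [SFinite μ] {a b c e : T → ℝ≥0∞} (ha : Measurable a) (hb : Measurable b)
    (hc : Measurable c) (he : Measurable e)
    (h : ∀ s t, a s * b t ≤ c (s ⊔ t) * e (s ⊓ t)) :
    (∫⁻ t, a t ∂μ) * (∫⁻ t, b t ∂μ) ≤ (∫⁻ t, c t ∂μ) * (∫⁻ t, e t ∂μ) := by
  have symmetrize : ∀ p q : T → ℝ≥0∞, Measurable p → Measurable q →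
      ∫⁻ z, (p z.1 * q z.2 + p z.2 * q z.1) ∂(μ.prod μ)
        = 2 * ((∫⁻ t, p t ∂μ) * (∫⁻ t, q t ∂μ)) := by
    intro p q hp hq
    rw [lintegral_add_left (by fun_prop), lintegral_prod_mul hp.aemeasurable hq.aemeasurable]
    simp_rw [mul_comm (p _) (q _)]
    rw [lintegral_prod_mul hq.aemeasurable hp.aemeasurable]
    ring
  have ordered : ∀ s t, s ≤ t → a s * b t + a t * b s ≤ c t * e s + c s * e t := by
    intro s t hst
    have hss := h s s
    have htt := h t t
    have h₁ := h s t
    have h₂ := h t s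
    simp only [sup_idem, inf_idem, sup_of_le_right hst, inf_of_le_left hst,
      sup_of_le_left hst, inf_of_le_right hst] at hss htt h₁ h₂
    refine ENNReal.add_le_add_of_mul_le_mul_of_le h₁ h₂ ?_
    calc a s * b t * (a t * b s) = a s * b s * (a t * b t) := by ring
      _ ≤ c s * e s * (c t * e t) := mul_le_mul' hss htt
      _ = c t * e s * (c s * e t) := by ring
  have key := lintegral_mono (μ := μ.prod μ)
    (f := fun z => a z.1 * b z.2 + a z.2 * b z.1)
    (g := fun z => c z.1 * e z.2 + c z.2 * e z.1) (fun z => by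
      rcases le_total z.1 z.2 with hz | hz
      · exact (ordered _ _ hz).trans_eq (add_comm _ _)
      · exact (add_comm _ _).trans_le (ordered _ _ hz))
  rw [symmetrize a b ha hb, symmetrize c e hc he] at key
  exact (ENNReal.mul_le_mul_iff_right two_ne_zero ENNReal.ofNat_ne_top).1 key

/-- Let `d ≥ 1` and let `f : ℝ^d × ℝ → [0,∞]` be measurable and strongly
MTP₂ as a function on `ℝ^{d+1}`. Then the marginal `g(x) = ∫ f(x,t) dt` (Lebesgue
integral, with values in `[0,∞]`) is strongly MTP₂. -/
theorem stronglyMTP2_marginal (d : ℕ) (hd : 1 ≤ d)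
    (f : (Fin d → ℝ) × ℝ → ℝ≥0∞) (hmeas : Measurable f)
    (hf : StronglyMTP2PairENN f) :
    StronglyMTP2ENN (fun x : Fin d → ℝ => ∫⁻ t : ℝ, f (x, t)) := by
  intro x y α hα
  have shift : ∀ u : Fin d → ℝ, ∫⁻ t : ℝ, f (u, t + α) = ∫⁻ t : ℝ, f (u, t) := fun u =>
    lintegral_add_right_eq_self (fun t => f (u, t)) α
  simp only
  rw [← shift y, ← shift ((x + α • (1 : Fin d → ℝ)) ⊓ y)]
  refine lintegral_mul_lintegral_le_of_sup_inf volume (by fun_prop) (by fun_prop) (by fun_prop)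
    (by fun_prop) fun s t => ?_
  convert hf (x, s) (y, t + α) α hα using 3
  · ext <;> simp
  · ext <;> simp [min_add_add_right]
end

section
/- Let d ≥ 1, fix a root k ∈ {1,…,d}, and let p : {1,…,d} → {1,…,d} satisfy p(k) = k and, for every v ∈ {1,…,d}, some iterate p^n(v) equals k (so p is the parent map of a tree rooted at k). Let f₁, …, f_d : ℝ → ℝ be nonnegative log-concave functions. Then the function g : ℝ^d → ℝ defined by g(z) = f_k(z_k)·∏_{v ≠ k} f_v(z_v − z_{p(v)}) is strongly MTP2 and log-concave (i.e., g((1−λ)z + λw) ≥ g(z)^{1−λ}·g(w)^{λ} for all z, w ∈ ℝ^d and λ ∈ [0,1]). -/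
/-- Multivariate log-concavity: `g((1−λ)z + λw) ≥ g(z)^{1−λ}·g(w)^{λ}`. -/
def LogConcaveVec {n : ℕ} (g : (Fin n → ℝ) → ℝ) : Prop :=
  ∀ (z w : Fin n → ℝ) (l : ℝ), 0 ≤ l → l ≤ 1 →
    g z ^ (1 - l) * g w ^ l ≤ g ((1 - l) • z + l • w)

theorem LogConcaveFun.mul_le_mul_of_le_of_le {h : ℝ → ℝ} (hh : LogConcaveFun h)
    (hnn : ∀ x, 0 ≤ h x) {a b c d : ℝ} (hac : a ≤ c) (hcb : c ≤ b) (hsum : c + d = a + b) :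
    h a * h b ≤ h c * h d := by
  rcases (hac.trans hcb).eq_or_lt with rfl | hab
  · obtain rfl : c = a := le_antisymm hcb hac
    obtain rfl : d = c := by linarith
    exact le_rfl
  have hpos : 0 < b - a := sub_pos.2 hab
  obtain ⟨l, hl⟩ : ∃ l, l = (c - a) / (b - a) := ⟨_, rfl⟩
  have hl0 : 0 ≤ l := hl ▸ div_nonneg (by linarith) hpos.le
  have hl1 : l ≤ 1 := by rw [hl, div_le_one hpos]; linarith
  have hmul : l * (b - a) = c - a := by rw [hl]; field_simp
  have hc := hh a b l hl0 hl1
  have hd := hh b a l hl0 hl1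
  rw [show (1 - l) * a + l * b = c by linarith] at hc
  rw [show (1 - l) * b + l * a = d by linarith] at hd
  have hsplit (x : ℝ) : h x = h x ^ (1 - l) * h x ^ l := by
    rw [← Real.rpow_add_of_nonneg (hnn x) (by linarith) hl0]
    simp
  calc h a * h b = (h a ^ (1 - l) * h a ^ l) * (h b ^ (1 - l) * h b ^ l) := by
        rw [← hsplit, ← hsplit]
    _ = (h a ^ (1 - l) * h b ^ l) * (h b ^ (1 - l) * h a ^ l) := by ring
    _ ≤ h c * h d := mul_le_mul hc hd
        (mul_nonneg (Real.rpow_nonneg (hnn _) _) (Real.rpow_nonneg (hnn _) _)) (hnn _)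

theorem LogConcaveFun.mul_le_mul_max_min {h : ℝ → ℝ} (hh : LogConcaveFun h)
    (hnn : ∀ x, 0 ≤ h x) (x y : ℝ) {α : ℝ} (hα : 0 ≤ α) :
    h x * h y ≤ h (max x (y - α)) * h (min (x + α) y) := by
  rcases le_total (y - α) x with hxy | hxy
  · rw [max_eq_left hxy, min_eq_right (by linarith)]
  · rw [max_eq_right hxy, min_eq_left (by linarith)]
    exact hh.mul_le_mul_of_le_of_le hnn hxy (by linarith) (by ring)

theorem LogConcaveFun.mul_le_mul_max_sub_max {h : ℝ → ℝ} (hh : LogConcaveFun h)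
    (hnn : ∀ x, 0 ≤ h x) (x y x' y' α : ℝ) :
    h (x - x') * h (y - y') ≤
      h (max x (y - α) - max x' (y' - α)) * h (min (x + α) y - min (x' + α) y') := by
  rcases le_total (y - α) x with h₁ | h₁ <;> rcases le_total (y' - α) x' with h₂ | h₂
  · rw [max_eq_left h₁, max_eq_left h₂, min_eq_right (by linarith), min_eq_right (by linarith)]
  · rw [max_eq_left h₁, max_eq_right h₂, min_eq_right (by linarith), min_eq_left (by linarith),
      mul_comm]
    exact hh.mul_le_mul_of_le_of_le hnn (by linarith) (by linarith) (by ring)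
  · rw [max_eq_right h₁, max_eq_left h₂, min_eq_left (by linarith), min_eq_right (by linarith)]
    exact hh.mul_le_mul_of_le_of_le hnn (by linarith) (by linarith) (by ring)
  · rw [max_eq_right h₁, max_eq_right h₂, min_eq_left (by linarith), min_eq_left (by linarith),
      mul_comm]
    exact le_of_eq (by ring_nf)


/-- Let `d ≥ 1`, `k` a root, `p` a parent map of a tree rooted at `k`
(`p(k) = k` and every vertex reaches `k` under iteration of `p`), and let
`f₁, …, f_d : ℝ → ℝ` be nonnegative log-concave functions. Then
`g(z) = f_k(z_k) · ∏_{v ≠ k} f_v(z_v − z_{p(v)})` is strongly MTP₂ and log-concave. -/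
theorem treeDensity_stronglyMTP2_logConcave (d : ℕ) (hd : 1 ≤ d)
    (k : Fin d) (p : Fin d → Fin d)
    (hpk : p k = k) (hroot : ∀ v : Fin d, ∃ n : ℕ, p^[n] v = k)
    (f : Fin d → ℝ → ℝ) (hnn : ∀ v x, 0 ≤ f v x) (hlc : ∀ v, LogConcaveFun (f v)) :
    StronglyMTP2 (fun z : Fin d → ℝ =>
        f k (z k) * ∏ v ∈ Finset.univ.filter (fun v => v ≠ k), f v (z v - z (p v))) ∧
    LogConcaveVec (fun z : Fin d → ℝ =>
        f k (z k) * ∏ v ∈ Finset.univ.filter (fun v => v ≠ k), f v (z v - z (p v))) := by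
  have hprod (s : Finset (Fin d)) (z : Fin d → ℝ) : 0 ≤ ∏ v ∈ s, f v (z v - z (p v)) :=
    Finset.prod_nonneg fun v _ => hnn v _
  refine ⟨fun x y α hα => ?_, fun z w l hl0 hl1 => ?_⟩
  · dsimp only
    rw [mul_mul_mul_comm (f k (x k)), mul_mul_mul_comm (f k ((x ⊔ (y - α • 1)) k)), ← Finset.prod_mul_distrib,
      ← Finset.prod_mul_distrib]
    refine mul_le_mul ?_ (Finset.prod_le_prod (fun v _ => mul_nonneg (hnn v _) (hnn v _))
      fun v _ => ?_) (Finset.prod_nonneg fun v _ => mul_nonneg (hnn v _) (hnn v _))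
      (mul_nonneg (hnn k _) (hnn k _))
    · simpa using (hlc k).mul_le_mul_max_min (hnn k) (x k) (y k) hα
    · simpa using (hlc v).mul_le_mul_max_sub_max (hnn v) (x v) (y v) (x (p v)) (y (p v)) α
  · dsimp only
    rw [Real.mul_rpow (hnn k _) (hprod _ z), Real.mul_rpow (hnn k _) (hprod _ w),
      mul_mul_mul_comm, ← Real.finsetProd_rpow _ _ (fun v _ => hnn v _),
      ← Real.finsetProd_rpow _ _ (fun v _ => hnn v _), ← Finset.prod_mul_distrib]
    have hrpow (v : Fin d) (a b : ℝ) : 0 ≤ f v a ^ (1 - l) * f v b ^ l :=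
      mul_nonneg (Real.rpow_nonneg (hnn v _) _) (Real.rpow_nonneg (hnn v _) _)
    refine mul_le_mul ?_ (Finset.prod_le_prod (fun v _ => hrpow v _ _) fun v _ => ?_)
      (Finset.prod_nonneg fun v _ => hrpow v _ _) (hnn k _)
    · simpa using hlc k (z k) (w k) l hl0 hl1
    · refine (hlc v (z v - z (p v)) (w v - w (p v)) l hl0 hl1).trans_eq (congrArg (f v) ?_)
      simp only [Pi.add_apply, Pi.smul_apply, smul_eq_mul]
      ring
end

section
/- Let d ≥ 1 and let λ : ℝ^d → ℝ be nonnegative and homogeneous in the sense that λ(y + t·𝟙) = e^{−t}·λ(y) for all y ∈ ℝ^d and all t ∈ ℝ. Fix k ∈ {1,…,d} and suppose that λ(x ∨ y)·λ(x ∧ y) ≥ λ(x)·λ(y) for all x, y ∈ ℝ^d with x_k > 0 and y_k > 0. Then for every k' ∈ {1,…,d}, the inequality λ(x ∨ y)·λ(x ∧ y) ≥ λ(x)·λ(y) holds for all x, y ∈ ℝ^d with x_{k'} > 0 and y_{k'} > 0. -/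
/-- Let `d ≥ 1` and `λ : ℝ^d → ℝ` be nonnegative and homogeneous in the sense
that `λ(y + t·𝟙) = e^{−t}·λ(y)` for all `y, t`. Fix `k` and suppose the MTP₂ inequality
`λ(x ∨ y)·λ(x ∧ y) ≥ λ(x)·λ(y)` holds for all `x, y` with `x_k > 0` and `y_k > 0`. Then
for every `k'` the same inequality holds for all `x, y` with `x_{k'} > 0` and `y_{k'} > 0`. -/
theorem mtp2_exponentMeasure_region_indep (d : ℕ) (hd : 1 ≤ d)
    (lam : (Fin d → ℝ) → ℝ) (hnn : ∀ y, 0 ≤ lam y)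
    (hhom : ∀ (y : Fin d → ℝ) (t : ℝ),
      lam (y + t • (1 : Fin d → ℝ)) = Real.exp (-t) * lam y)
    (k : Fin d)
    (hk : ∀ x y : Fin d → ℝ, 0 < x k → 0 < y k →
      lam x * lam y ≤ lam (x ⊔ y) * lam (x ⊓ y)) :
    ∀ (k' : Fin d) (x y : Fin d → ℝ), 0 < x k' → 0 < y k' →
      lam x * lam y ≤ lam (x ⊔ y) * lam (x ⊓ y) := by
  intro _ x y _ _
  set t : ℝ := |x k| + |y k| + 1
  have hx : 0 < (x + t • (1 : Fin d → ℝ)) k := by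
    simp only [Pi.add_apply, Pi.smul_apply, Pi.one_apply, smul_eq_mul, mul_one]
    linarith [neg_abs_le (x k), abs_nonneg (y k)]
  have hy : 0 < (y + t • (1 : Fin d → ℝ)) k := by
    simp only [Pi.add_apply, Pi.smul_apply, Pi.one_apply, smul_eq_mul, mul_one]
    linarith [neg_abs_le (y k), abs_nonneg (x k)]
  have h := hk _ _ hx hy
  rw [← sup_add, ← inf_add] at h
  simp only [hhom] at h
  rw [mul_mul_mul_comm, mul_mul_mul_comm _ (lam (x ⊔ y))] at h
  exact le_of_mul_le_mul_left h (mul_pos (Real.exp_pos _) (Real.exp_pos _))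
end

section
/- Let Γ be a symmetric d×d real matrix with zero diagonal. (a) For every symmetric d×d matrix Θ with Θ·𝟙 = 0, tr(P·(−Γ/2)·P·Θ) = −Σ_{1≤i<j≤d} Γ_{ij}·Θ_{ij}. (b) Fix k ∈ {1,…,d} and set P_k = I_d − 𝟙·e_kᵀ, where e_k is the k-th standard basis vector. For every symmetric d×d matrix Θ̃ with Θ̃·e_k = 0, tr(P_k·(−Γ/2)·P_kᵀ·Θ̃) = Σ_{1≤i<j≤d} Γ_{ij}·Q_{ij}, where Q_{ij} = −Θ̃_{ij} for i, j ≠ k and Q_{ik} = Q_{ki} = Σ_{j≠k} Θ̃_{ij} for i ≠ k. -/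
open Matrix

/-- `P := I_d − (1/d)·𝟙𝟙ᵀ`, the orthogonal projection onto `𝟙^⊥`. -/
noncomputable def projP (d : ℕ) : Matrix (Fin d) (Fin d) ℝ :=
  (1 : Matrix (Fin d) (Fin d) ℝ) -
    ((d : ℝ)⁻¹) • Matrix.vecMulVec (fun _ => 1) (fun _ => 1)

/-- `P_k := I_d − 𝟙·e_kᵀ`. -/
def projPk {d : ℕ} (k : Fin d) : Matrix (Fin d) (Fin d) ℝ :=
  (1 : Matrix (Fin d) (Fin d) ℝ) -
    Matrix.vecMulVec (fun _ => 1) (Pi.single k 1)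

lemma sum_sum_eq_two_mul_sum_filter_lt {ι R : Type*} [Fintype ι] [LinearOrder ι]
    [NonAssocSemiring R] (f : ι → ι → R) (hsymm : ∀ i j, f i j = f j i) (hdiag : ∀ i, f i i = 0) :
    ∑ i, ∑ j, f i j = 2 * ∑ i, ∑ j ∈ Finset.univ.filter (fun j => i < j), f i j := by
  have hsplit : ∀ i j, f i j = (if i < j then f i j else 0) + (if j < i then f j i else 0) := by
    intro i j
    rcases lt_trichotomy i j with h | rfl | h
    · simp [h, h.not_gt]
    · simp [hdiag]
    · simp [h, h.not_gt, hsymm i j]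
  simp_rw [Finset.sum_filter]
  rw [two_mul, Finset.sum_congr rfl fun i _ => Finset.sum_congr rfl fun j _ => hsplit i j]
  simp_rw [Finset.sum_add_distrib]
  congr 1
  exact Finset.sum_comm

lemma trace_neg_half_smul_mul {d : ℕ} {Γ M : Matrix (Fin d) (Fin d) ℝ} (hΓ : Γ.IsSymm)
    (hdiag : ∀ i, Γ i i = 0) (hM : M.IsSymm) :
    (((-(1/2 : ℝ)) • Γ) * M).trace =
      -∑ i : Fin d, ∑ j ∈ Finset.univ.filter (fun j => i < j), Γ i j * M i j := by
  have h := sum_sum_eq_two_mul_sum_filter_lt (fun i j => Γ i j * M i j)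
    (fun i j => by rw [hΓ.apply, hM.apply]) (fun i => by simp [hdiag])
  have htr : (Γ * M).trace = ∑ i, ∑ j, Γ i j * M i j := by
    simp only [Matrix.trace, Matrix.diag, Matrix.mul_apply]
    exact Finset.sum_congr rfl fun i _ => Finset.sum_congr rfl fun j _ => by rw [hM.apply]
  rw [Matrix.smul_mul, Matrix.trace_smul, htr, h, smul_eq_mul]
  ring

lemma projP_isSymm (d : ℕ) : (projP d).IsSymm := by
  ext i j
  simp [projP, Matrix.one_apply, Matrix.vecMulVec_apply, eq_comm]

lemma mul_projP {d : ℕ} {Θ : Matrix (Fin d) (Fin d) ℝ} (h : Θ.mulVec (fun _ => 1) = 0) :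
    Θ * projP d = Θ := by
  simp [projP, Matrix.mul_sub, Matrix.mul_vecMulVec, h]

lemma projPk_transpose_mul_mul_apply {d : ℕ} (k : Fin d) (Θ : Matrix (Fin d) (Fin d) ℝ)
    (i j : Fin d) :
    ((projPk k)ᵀ * Θ * projPk k) i j =
      Θ i j - (if i = k then ∑ l, Θ l j else 0) - (if j = k then ∑ l, Θ i l else 0) +
        (if i = k ∧ j = k then ∑ l, ∑ m, Θ m l else 0) := by
  simp only [projPk, Matrix.transpose_sub, Matrix.transpose_one, Matrix.transpose_vecMulVec,
    Matrix.mul_sub, Matrix.sub_mul, Matrix.one_mul, Matrix.mul_one, Matrix.vecMulVec_mul,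
    Matrix.mul_vecMulVec, Matrix.sub_apply, Matrix.vecMulVec_apply, Matrix.sub_mulVec,
    Matrix.mulVec, Matrix.vecMul, dotProduct, Pi.single_apply, Pi.sub_apply]
  by_cases hi : i = k <;> by_cases hj : j = k <;> simp [hi, hj]
  ring

/-- Let `Γ` be symmetric with zero diagonal.
(a) For every symmetric `Θ` with `Θ·𝟙 = 0`,
`tr(P·(−Γ/2)·P·Θ) = −Σ_{i<j} Γ_{ij}·Θ_{ij}`.
(b) Fix `k` and `P_k = I_d − 𝟙e_kᵀ`. For every symmetric `Θ̃` with `Θ̃·e_k = 0`,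
`tr(P_k·(−Γ/2)·P_kᵀ·Θ̃) = Σ_{i<j} Γ_{ij}·Q_{ij}`, where `Q_{ij} = −Θ̃_{ij}` for
`i, j ≠ k` and `Q_{ik} = Q_{ki} = Σ_{j≠k} Θ̃_{ij}` for `i ≠ k`. -/
theorem trace_covarianceMap_adjoint (d : ℕ)
    (Γ : Matrix (Fin d) (Fin d) ℝ) (hsym : Γ.IsSymm) (hdiag : ∀ i, Γ i i = 0) :
    (∀ Θ : Matrix (Fin d) (Fin d) ℝ, Θ.IsSymm → Θ.mulVec (fun _ => 1) = 0 →
      (projP d * ((-(1/2 : ℝ)) • Γ) * projP d * Θ).trace =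
        -∑ i : Fin d, ∑ j ∈ Finset.univ.filter (fun j => i < j), Γ i j * Θ i j) ∧
    (∀ (k : Fin d) (Θt : Matrix (Fin d) (Fin d) ℝ), Θt.IsSymm →
      Θt.mulVec (Pi.single k 1) = 0 →
      (projPk k * ((-(1/2 : ℝ)) • Γ) * (projPk k)ᵀ * Θt).trace =
        ∑ i : Fin d, ∑ j ∈ Finset.univ.filter (fun j => i < j),
          Γ i j *
            (if j = k then ∑ l ∈ Finset.univ.filter (fun l => l ≠ k), Θt i l
             else if i = k then ∑ l ∈ Finset.univ.filter (fun l => l ≠ k), Θt j l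
             else -Θt i j)) := by
  refine ⟨fun Θ hΘ h1 => ?_, fun k Θ hΘ hk => ?_⟩
  · have hP : projP d * Θ = Θ := by
      simpa [Matrix.transpose_mul, (projP_isSymm d).eq, hΘ.eq] using
        congrArg Matrix.transpose (mul_projP h1)
    rw [Matrix.mul_assoc, hP, Matrix.mul_assoc, Matrix.trace_mul_comm, Matrix.mul_assoc,
      mul_projP h1, trace_neg_half_smul_mul hsym hdiag hΘ]
  · have hM : ((projPk k)ᵀ * Θ * projPk k).IsSymm := by
      simp [Matrix.IsSymm, Matrix.transpose_mul, hΘ.eq, Matrix.mul_assoc]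
    have hcol : ∀ i, Θ i k = 0 := fun i => by simpa using congrFun hk i
    have hrow : ∀ i, ∑ l ∈ Finset.univ.filter (fun l => l ≠ k), Θ i l = ∑ l, Θ i l := fun i =>
      Finset.sum_filter_of_ne fun l _ hl hlk => hl (hlk ▸ hcol i)
    rw [Matrix.mul_assoc, Matrix.mul_assoc, Matrix.trace_mul_comm, Matrix.mul_assoc,
      trace_neg_half_smul_mul hsym hdiag hM, ← Finset.sum_neg_distrib]
    refine Finset.sum_congr rfl fun i _ => ?_
    rw [← Finset.sum_neg_distrib]
    refine Finset.sum_congr rfl fun j hj => ?_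
    have hij : i ≠ j := (Finset.mem_filter.mp hj).2.ne
    rw [projPk_transpose_mul_mul_apply, hrow, hrow, ← mul_neg]
    congr 1
    by_cases hjk : j = k
    · subst hjk
      simp [hij, hcol]
    · by_cases hik : i = k
      · subst hik
        simp [hjk, ← hΘ.apply i j, hcol, fun l => hΘ.apply j l]
      · simp [hik, hjk]
end

section
/- Let d ≥ 1 and let Θ be a symmetric real d×d matrix with Θ·𝟙 = 0; set Q_{ij} = −Θ_{ij} for i ≠ j. Then for every k ∈ {1,…,d}, the determinant of the (d−1)×(d−1) matrix obtained from Θ by deleting the k-th row and the k-th column equals Σ_T ∏_{{i,j}∈E(T)} Q_{ij}, where the sum ranges over all spanning trees T of the complete graph on the vertex set {1,…,d}. In particular, this determinant is the same for every choice of k. -/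
open Matrix
open scoped Classical

/-- The weight of an unordered pair `{i,j}` given by a matrix `Q`, symmetrized so that
it is well defined; for symmetric `Q` this is just `Q i j`. -/
noncomputable def edgeWeight {d : ℕ} (Q : Matrix (Fin d) (Fin d) ℝ) : Sym2 (Fin d) → ℝ :=
  Sym2.lift ⟨fun i j => (Q i j + Q j i) / 2, fun i j => by ring⟩

/-- The sum over all spanning trees `T` of the complete graph on `{1,…,d}` of the products
`∏_{{i,j}∈E(T)} Q_{ij}`. A spanning tree is encoded as a finite set of unordered pairs
whose associated graph is a tree (connected and acyclic) on all of `Fin d`. -/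
noncomputable def treeSum {d : ℕ} (Q : Matrix (Fin d) (Fin d) ℝ) : ℝ :=
  ∑ T ∈ Finset.univ.filter (fun T : Finset (Sym2 (Fin d)) =>
      (SimpleGraph.fromEdgeSet (↑T : Set (Sym2 (Fin d)))).IsTree ∧
      (SimpleGraph.fromEdgeSet (↑T : Set (Sym2 (Fin d)))).edgeSet = (↑T : Set (Sym2 (Fin d)))),
    ∏ e ∈ T, edgeWeight Q e

section ParentFunction

variable {V : Type*} {k : V}

/-- A parent function on the vertices other than `k` is rooted if it strictly decreases some
rank, i.e. if following parents leads every vertex to `k`. -/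
def IsRooted (f : {i : V // i ≠ k} → V) : Prop :=
  ∃ r : V → ℕ, ∀ i, r (f i) < r i

/-- The edges joining each vertex other than `k` to its parent. -/
def parentEdges [Fintype V] [DecidableEq V] (f : {i : V // i ≠ k} → V) : Finset (Sym2 V) :=
  Finset.univ.image fun i : {i : V // i ≠ k} => s((i : V), f i)

/-- The matrix with rows `e_i - e_{f i}`, restricted to the vertices other than `k`. -/
def parentMatrix (R : Type*) [CommRing R] [DecidableEq V] (f : {i : V // i ≠ k} → V) :
    Matrix {i : V // i ≠ k} {i : V // i ≠ k} R :=
  Matrix.of fun i j => (if (i : V) = j then 1 else 0) - if f i = j then 1 else 0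

theorem IsRooted.edge_injective {f : {i : V // i ≠ k} → V} (hf : IsRooted f) :
    Function.Injective fun i : {i : V // i ≠ k} => s((i : V), f i) := by
  obtain ⟨r, hr⟩ := hf
  intro i j hij
  rcases Sym2.eq_iff.1 hij with ⟨h, -⟩ | ⟨h, h'⟩
  · exact Subtype.ext h
  · have hi := hr i
    have hj := hr j
    rw [h'] at hi
    rw [← h] at hj
    omega

theorem IsRooted.eq_of_parentEdges_eq [Fintype V] [DecidableEq V] {f g : {i : V // i ≠ k} → V}
    (hf : IsRooted f) (h : parentEdges f = parentEdges g) : f = g := by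
  obtain ⟨r, hr⟩ := hf
  have key : ∀ n, ∀ i : {i : V // i ≠ k}, r i = n → f i = g i := by
    intro n
    induction n using Nat.strong_induction_on with
    | _ n ih =>
      intro i hi
      have hmem : s((i : V), f i) ∈ parentEdges g :=
        h ▸ Finset.mem_image_of_mem _ (Finset.mem_univ i)
      obtain ⟨j, -, hj⟩ := Finset.mem_image.1 hmem
      rcases Sym2.eq_iff.1 hj with ⟨h₁, h₂⟩ | ⟨h₁, h₂⟩
      · rw [← h₂, Subtype.ext h₁]
      · have hlt := hr i
        rw [← h₁] at hlt
        have hji := hr j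
        rw [ih (r j) (hi ▸ hlt) j rfl, h₂] at hji
        omega
  exact funext fun i => key _ i rfl

theorem IsRooted.prod_parentEdges {M : Type*} [CommMonoid M] [Fintype V] [DecidableEq V]
    {f : {i : V // i ≠ k} → V} (hf : IsRooted f) (w : Sym2 V → M) :
    ∏ e ∈ parentEdges f, w e = ∏ i : {i : V // i ≠ k}, w s((i : V), f i) :=
  Finset.prod_image hf.edge_injective.injOn

theorem IsRooted.parentEdges_card [Fintype V] [DecidableEq V]
    {f : {i : V // i ≠ k} → V} (hf : IsRooted f) :
    (parentEdges f).card + 1 = Fintype.card V := by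
  rw [parentEdges, Finset.card_image_of_injective _ hf.edge_injective, Finset.card_univ,
    Fintype.card_subtype_compl, Fintype.card_subtype_eq]
  have := Fintype.card_pos_iff.2 ⟨k⟩
  omega

theorem edgeSet_fromEdgeSet_parentEdges [Fintype V] [DecidableEq V] {f : {i : V // i ≠ k} → V}
    (hf : IsRooted f) :
    (SimpleGraph.fromEdgeSet (parentEdges f : Set (Sym2 V))).edgeSet = parentEdges f := by
  obtain ⟨r, hr⟩ := hf
  rw [SimpleGraph.edgeSet_fromEdgeSet, sdiff_eq_left, Set.disjoint_left]
  intro e he hd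
  obtain ⟨i, -, rfl⟩ := Finset.mem_image.1 (Finset.mem_coe.1 he)
  have h : (i : V) = f i := by simpa using hd
  have := hr i
  rw [← h] at this
  omega

theorem isTree_fromEdgeSet_parentEdges [Fintype V] [DecidableEq V] {f : {i : V // i ≠ k} → V}
    (hf : IsRooted f) :
    (SimpleGraph.fromEdgeSet (parentEdges f : Set (Sym2 V))).IsTree := by
  rw [SimpleGraph.isTree_iff_connected_and_card]
  constructor
  · obtain ⟨r, hr⟩ := hf
    have key : ∀ n, ∀ i : V, r i = n →
        (SimpleGraph.fromEdgeSet (parentEdges f : Set (Sym2 V))).Reachable i k := by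
      intro n
      induction n using Nat.strong_induction_on with
      | _ n ih =>
        intro i hi
        by_cases hik : i = k
        · rw [hik]
        · have hlt := hr ⟨i, hik⟩
          refine SimpleGraph.Reachable.trans (SimpleGraph.Adj.reachable ?_)
            (ih _ (hi ▸ hlt) (f ⟨i, hik⟩) rfl)
          rw [SimpleGraph.fromEdgeSet_adj]
          refine ⟨Finset.mem_image_of_mem _ (Finset.mem_univ (⟨i, hik⟩ : {i : V // i ≠ k})), ?_⟩
          intro h
          rw [← h] at hlt
          exact lt_irrefl _ hlt
    have : Nonempty V := ⟨k⟩
    exact ⟨fun i j => (key _ i rfl).trans (key _ j rfl).symm⟩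
  · rw [edgeSet_fromEdgeSet_parentEdges hf, Nat.card_eq_fintype_card, Nat.card_eq_fintype_card,
      ← hf.parentEdges_card]
    simp

theorem SimpleGraph.Connected.exists_adj_dist_lt {G : SimpleGraph V} (hG : G.Connected) {i : V}
    (hi : i ≠ k) : ∃ j, G.Adj i j ∧ G.dist j k < G.dist i k := by
  obtain ⟨p, hp⟩ := hG.exists_walk_length_eq_dist i k
  cases p with
  | nil => exact absurd rfl hi
  | cons h q =>
    refine ⟨_, h, ?_⟩
    rw [← hp, SimpleGraph.Walk.length_cons]
    exact Nat.lt_succ_of_le (SimpleGraph.dist_le q)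

theorem exists_isRooted_parentEdges_eq [Fintype V] [DecidableEq V] (k : V) {T : Finset (Sym2 V)}
    (hT : (SimpleGraph.fromEdgeSet (T : Set (Sym2 V))).IsTree)
    (hT' : (SimpleGraph.fromEdgeSet (T : Set (Sym2 V))).edgeSet = T) :
    ∃ f : {i : V // i ≠ k} → V, IsRooted f ∧ parentEdges f = T := by
  choose f hadj hdist using fun i : {i : V // i ≠ k} =>
    hT.connected.exists_adj_dist_lt i.2
  have hf : IsRooted f := ⟨fun i => SimpleGraph.dist _ i k, hdist⟩
  refine ⟨f, hf, Finset.eq_of_subset_of_card_le ?_ ?_⟩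
  · intro e he
    obtain ⟨i, -, rfl⟩ := Finset.mem_image.1 he
    exact ((SimpleGraph.fromEdgeSet_adj _).1 (hadj i)).1
  · have h := (SimpleGraph.isTree_iff_connected_and_card.1 hT).2
    rw [hT', Nat.card_eq_fintype_card, Nat.card_eq_fintype_card, ← hf.parentEdges_card] at h
    simp only [Finset.coe_sort_coe, Fintype.card_coe] at h
    omega

theorem det_parentMatrix_of_isRooted (R : Type*) [CommRing R] [Fintype V] [DecidableEq V]
    {f : {i : V // i ≠ k} → V} (hf : IsRooted f) : (parentMatrix R f).det = 1 := by
  obtain ⟨r, hr⟩ := hf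
  have htri : (parentMatrix R f).BlockTriangular
      fun i : {i : V // i ≠ k} => OrderDual.toDual (r i) := by
    intro i j hij
    have hij' : r i < r j := OrderDual.toDual_lt_toDual.1 hij
    have h₁ : (i : V) ≠ j := fun h => by rw [h] at hij'; exact lt_irrefl _ hij'
    have h₂ : f i ≠ j := fun h => by
      have := hr i
      rw [h] at this
      omega
    simp [parentMatrix, h₁, h₂]
  rw [htri.det]
  refine Finset.prod_eq_one fun a _ => ?_
  have hblock : (parentMatrix R f).toSquareBlock
      (fun i : {i : V // i ≠ k} => OrderDual.toDual (r i)) a = 1 := by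
    ext i j
    have hij : r i.1 = r j.1 := OrderDual.toDual.injective (i.2.trans j.2.symm)
    have h₂ : f i.1 ≠ j.1 := fun h => by
      have := hr i.1
      rw [h] at this
      omega
    simp [parentMatrix, Matrix.toSquareBlock_def, Matrix.one_apply, h₂, Subtype.ext_iff]
  rw [hblock, Matrix.det_one]

theorem isRooted_of_iterate {f : {i : V // i ≠ k} → V} {F : V → V}
    (hF : ∀ i : {i : V // i ≠ k}, F i = f i) (h : ∀ i, ∃ n, F^[n] i = k) : IsRooted f := by
  classical
  refine ⟨fun i => Nat.find (h i), fun i => ?_⟩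
  have hspec := Nat.find_spec (h i)
  obtain ⟨m, hm⟩ : ∃ m, Nat.find (h i) = m + 1 := by
    refine Nat.exists_eq_succ_of_ne_zero fun h₀ => i.2 ?_
    rwa [h₀] at hspec
  rw [hm, Function.iterate_succ_apply, hF] at hspec
  show Nat.find (h (f i)) < Nat.find (h i)
  rw [hm]
  exact Nat.lt_succ_of_le (Nat.find_min' _ hspec)

theorem det_parentMatrix_of_not_isRooted (R : Type*) [CommRing R] [IsDomain R] [Fintype V]
    [DecidableEq V] {f : {i : V // i ≠ k} → V} (hf : ¬ IsRooted f) :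
    (parentMatrix R f).det = 0 := by
  classical
  let F : V → V := fun i => if h : i ≠ k then f ⟨i, h⟩ else k
  have hF : ∀ i : {i : V // i ≠ k}, F i = f i := fun i => dif_pos i.2
  have hex : ∃ i, ∀ n, F^[n] i ≠ k := by
    by_contra! h
    exact hf (isRooted_of_iterate hF h)
  obtain ⟨i₀, hi₀⟩ := hex
  let v : V → R := fun i => if ∀ n, F^[n] i ≠ k then 1 else 0
  have hvk : v k = 0 := if_neg fun h => h 0 rfl
  have hvf : ∀ i : {i : V // i ≠ k}, v (f i) = v i := by
    intro i
    have : (∀ n, F^[n] (f i) ≠ k) ↔ ∀ n, F^[n] i ≠ k := by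
      rw [← hF]
      refine ⟨fun h n => ?_, fun h n => h (n + 1)⟩
      cases n with
      | zero => exact i.2
      | succ n => exact h n
    simp only [v, this]
  have hsum : ∀ a : V, ∑ j : {i : V // i ≠ k}, (if a = j then (1 : R) else 0) * v j = v a := by
    intro a
    by_cases ha : a = k
    · rw [ha, hvk]
      exact Finset.sum_eq_zero fun j _ => by simp [j.2.symm]
    · rw [Finset.sum_eq_single ⟨a, ha⟩]
      · simp
      · intro b _ hb
        have : a ≠ b := fun h => hb (Subtype.ext h.symm)
        simp [this]
      · simp
  refine Matrix.exists_mulVec_eq_zero_iff.1 ⟨fun i => v i, fun h => ?_, ?_⟩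
  · have := congrFun h ⟨i₀, hi₀ 0⟩
    simp [v, hi₀] at this
  · ext i
    simp only [Matrix.mulVec, dotProduct, parentMatrix, Matrix.of_apply, sub_mul,
      Finset.sum_sub_distrib, hsum, hvf, sub_self, Pi.zero_apply]

theorem det_minor_eq_sum_isRooted {R : Type*} [CommRing R] [IsDomain R] [Fintype V]
    [DecidableEq V] (A : Matrix V V R) (hA : ∀ i, ∑ j, A i j = 0) (k : V) :
    (A.submatrix (fun i : {i : V // i ≠ k} => (i : V)) fun j : {j : V // j ≠ k} => (j : V)).det =
      ∑ f : {i : V // i ≠ k} → V with IsRooted f,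
        ∏ i : {i : V // i ≠ k}, -A i (f i) := by
  let row : {i : V // i ≠ k} → V → {i : V // i ≠ k} → R := fun i a j =>
    (if (i : V) = j then 1 else 0) - if a = j then 1 else 0
  have hrows : (A.submatrix (fun i : {i : V // i ≠ k} => (i : V))
      fun j : {j : V // j ≠ k} => (j : V)) = fun i : {i : V // i ≠ k} => ∑ a, -A i a • row i a := by
    ext i j
    simp [row, mul_sub, hA]
  have hexp := (Matrix.detRowAlternating (n := {i : V // i ≠ k}) (R := R)).toMultilinearMap.map_sum
    (fun (i : {i : V // i ≠ k}) a => -A i a • row i a)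
  rw [hrows]
  refine hexp.trans ?_
  rw [Finset.sum_filter]
  refine Finset.sum_congr rfl fun f _ => ?_
  rw [MultilinearMap.map_smul_univ]
  change _ • (parentMatrix R f).det = _
  split_ifs with hf
  · rw [det_parentMatrix_of_isRooted R hf, smul_eq_mul, mul_one]
  · rw [det_parentMatrix_of_not_isRooted R hf, smul_zero]

end ParentFunction

theorem treeSum_eq_sum_isRooted {d : ℕ} {Q : Matrix (Fin d) (Fin d) ℝ} (hQ : Q.IsSymm)
    (k : Fin d) :
    treeSum Q = ∑ f : {i : Fin d // i ≠ k} → Fin d with IsRooted f,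
      ∏ i : {i : Fin d // i ≠ k}, Q i (f i) := by
  symm
  refine Finset.sum_bij (fun f _ => parentEdges f) ?_ ?_ ?_ ?_
  · intro f hf
    have hf' := (Finset.mem_filter.1 hf).2
    exact Finset.mem_filter.2 ⟨Finset.mem_univ _, isTree_fromEdgeSet_parentEdges hf',
      edgeSet_fromEdgeSet_parentEdges hf'⟩
  · intro f hf g _ h
    exact (Finset.mem_filter.1 hf).2.eq_of_parentEdges_eq h
  · intro T hT
    obtain ⟨-, hT₁, hT₂⟩ := Finset.mem_filter.1 hT
    obtain ⟨f, hf, rfl⟩ := exists_isRooted_parentEdges_eq k hT₁ hT₂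
    exact ⟨f, Finset.mem_filter.2 ⟨Finset.mem_univ _, hf⟩, rfl⟩
  · intro f hf
    rw [(Finset.mem_filter.1 hf).2.prod_parentEdges]
    refine Finset.prod_congr rfl fun i _ => ?_
    have := hQ.apply i (f i)
    simp only [edgeWeight, Sym2.lift_mk, this]
    ring

/-- weighted matrix-tree theorem: Let `Θ` be symmetric with `Θ·𝟙 = 0` and
`Q_{ij} = −Θ_{ij}`. For every `k`, the determinant of the matrix obtained from `Θ` by
deleting the `k`-th row and column equals `Σ_T ∏_{{i,j}∈E(T)} Q_{ij}`, summing over all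
spanning trees of the complete graph on `{1,…,d}`. In particular it does not depend
on `k`. -/
theorem matrixTree_minor_det (d : ℕ) (hd : 1 ≤ d)
    (Θ : Matrix (Fin d) (Fin d) ℝ) (hsym : Θ.IsSymm)
    (h1 : Θ.mulVec (fun _ => 1) = 0) :
    ∀ k : Fin d,
      (Θ.submatrix (fun i : {i : Fin d // i ≠ k} => (i : Fin d))
          (fun j : {j : Fin d // j ≠ k} => (j : Fin d))).det =
        treeSum (Matrix.of fun i j => -Θ i j) := by
  intro k
  have hQ : (Matrix.of fun i j => -Θ i j).IsSymm :=
    Matrix.IsSymm.ext fun i j => congrArg Neg.neg (hsym.apply i j)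
  rw [treeSum_eq_sum_isRooted hQ k]
  have hrow : ∀ i, ∑ j, Θ i j = 0 := fun i => by
    simpa [Matrix.mulVec, dotProduct] using congrFun h1 i
  exact det_minor_eq_sum_isRooted Θ hrow k
end

section
/- Let d ≥ 2, let Γ be a symmetric d×d real matrix with zero diagonal, and fix k ∈ {1,…,d}. Then det Σ^{(k)} = det M, where M is the (d+1)×(d+1) matrix whose (1,1) entry is 0, whose first row after the corner is −𝟙ᵀ, whose first column after the corner is 𝟙, and whose remaining d×d block is −Γ/2 (Cayley–Menger formula). In particular, det Σ^{(k)} does not depend on k. -/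
open Matrix

/-- The covariance mapping `Σ^{(k)}_{ij} = (Γ_{ik} + Γ_{jk} − Γ_{ij})/2`. -/
noncomputable def SigmaK {d : ℕ} (Γ : Matrix (Fin d) (Fin d) ℝ) (k : Fin d) :
    Matrix {i : Fin d // i ≠ k} {i : Fin d // i ≠ k} ℝ :=
  Matrix.of fun i j => (Γ i.1 k + Γ j.1 k - Γ i.1 j.1) / 2

/-- The `(d+1)×(d+1)` Cayley–Menger matrix: corner entry `0`, first row `−𝟙ᵀ`,
first column `𝟙`, lower-right block `−Γ/2`. The index `none` is the added first
row/column. -/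
noncomputable def cayleyM {d : ℕ} (Γ : Matrix (Fin d) (Fin d) ℝ) :
    Matrix (Option (Fin d)) (Option (Fin d)) ℝ :=
  Matrix.of fun i j =>
    match i, j with
    | none, none => 0
    | none, some _ => -1
    | some _, none => 1
    | some a, some b => -Γ a b / 2

/-- Splitting the index set of the Cayley–Menger matrix into the indices other than `k` and the
pair consisting of `k` and the added index. -/
theorem bijective_elim_some_val {α : Type*} (k : α) :
    Function.Bijective
      (Sum.elim (fun i : {i : α // i ≠ k} => some i.1) ![some k, none]) := by
  constructor
  · rintro (⟨i, hi⟩ | i) (⟨j, hj⟩ | j) h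
    · simpa using h
    · fin_cases j <;> simp_all
    · fin_cases i <;> simp [hj.symm] at h
    · fin_cases i <;> fin_cases j <;> simp_all
  · rintro (_ | i)
    · exact ⟨Sum.inr 1, by simp⟩
    · by_cases hi : i = k
      · exact ⟨Sum.inr 0, by simp [hi]⟩
      · exact ⟨Sum.inl ⟨i, hi⟩, by simp⟩

/-- Cayley–Menger formula: Let `d ≥ 2` and `Γ` symmetric with zero
diagonal. Then for every `k`, `det Σ^{(k)} = det M`, where `M` is the Cayley–Menger
matrix. In particular `det Σ^{(k)}` does not depend on `k`. -/
theorem det_sigmaK_eq_cayleyMenger (d : ℕ) (hd : 2 ≤ d)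
    (Γ : Matrix (Fin d) (Fin d) ℝ) (hsym : Γ.IsSymm) (hdiag : ∀ i, Γ i i = 0) :
    ∀ k : Fin d, (SigmaK Γ k).det = (cayleyM Γ).det := by
  intro k
  let e := Equiv.ofBijective _ (bijective_elim_some_val k)
  let D : Matrix (Fin 2) (Fin 2) ℝ := !![0, 1; -1, 0]
  let E : Matrix (Fin 2) (Fin 2) ℝ := !![0, -1; 1, 0]
  let A : Matrix {i : Fin d // i ≠ k} {i : Fin d // i ≠ k} ℝ := of fun i j => -Γ i.1 j.1 / 2
  let B : Matrix {i : Fin d // i ≠ k} (Fin 2) ℝ := of fun i => ![-Γ i.1 k / 2, 1]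
  let C : Matrix (Fin 2) {i : Fin d // i ≠ k} ℝ := of ![fun j => -Γ k j.1 / 2, fun _ => -1]
  have hblocks : (cayleyM Γ).submatrix e e = fromBlocks A B C D := by
    ext (i | i) (j | j)
    · simp [e, A, cayleyM]
    · fin_cases j <;> simp [e, B, cayleyM]
    · fin_cases i <;> simp [e, C, cayleyM]
    · fin_cases i <;> fin_cases j <;> simp [e, D, cayleyM, hdiag]
  have hED : E * D = 1 := by
    ext i j
    fin_cases i <;> fin_cases j <;> simp [E, D]
  have hDE : D * E = 1 := mul_eq_one_comm.mp hED
  let : Invertible D := ⟨E, hED, hDE⟩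
  have hdet : D.det = 1 := by simp [D, det_fin_two]
  rw [← det_submatrix_equiv_self e, hblocks, det_fromBlocks₂₂, hdet, one_mul]
  congr 1
  ext i j
  change _ = (A - B * E * C) i j
  simp [SigmaK, A, B, C, E, mul_apply, Fin.sum_univ_two, hsym.apply k j.1]
  ring
end

section
/- Let d ≥ 2 and let Γ̄ be a symmetric d×d real matrix with zero diagonal. For a symmetric d×d matrix Q with zero diagonal, nonnegative entries, and τ(Q) > 0, define ℓ(Q) = log τ(Q) − Σ_{1≤i<j≤d} Γ̄_{ij}·Q_{ij}. Then the supremum of ℓ over the set {Q symmetric, zero diagonal, Q_{ij} ≥ 0 for all i ≠ j, τ(Q) > 0} is attained at some Q in this set if and only if Γ̄_{ij} > 0 for all 1 ≤ i < j ≤ d. -/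
open Matrix
open scoped Classical

/-- The surrogate log-likelihood `ℓ(Q) = log τ(Q) − Σ_{i<j} Γ̄_{ij}·Q_{ij}`. -/
noncomputable def surrogateLL {d : ℕ} (Γb Q : Matrix (Fin d) (Fin d) ℝ) : ℝ :=
  Real.log (treeSum Q) -
    ∑ i : Fin d, ∑ j ∈ Finset.univ.filter (fun j => i < j), Γb i j * Q i j

theorem edgeWeight_mk {d : ℕ} {Q : Matrix (Fin d) (Fin d) ℝ} (hQ : Q.IsSymm) (i j : Fin d) :
    edgeWeight Q s(i, j) = Q i j := by
  have h : Q j i = Q i j := hQ.apply i j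
  change (Q i j + Q j i) / 2 = Q i j
  rw [h]; ring

theorem edgeWeight_nonneg {d : ℕ} {Q : Matrix (Fin d) (Fin d) ℝ} (hQ : ∀ i j, 0 ≤ Q i j)
    (e : Sym2 (Fin d)) : 0 ≤ edgeWeight Q e := by
  induction e with
  | _ i j => exact div_nonneg (add_nonneg (hQ i j) (hQ j i)) two_pos.le

theorem edgeWeight_mono {d : ℕ} {Q Q' : Matrix (Fin d) (Fin d) ℝ} (h : ∀ i j, Q i j ≤ Q' i j)
    (e : Sym2 (Fin d)) : edgeWeight Q e ≤ edgeWeight Q' e := by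
  induction e with
  | _ i j => exact div_le_div_of_nonneg_right (add_le_add (h i j) (h j i)) two_pos.le

theorem edgeWeight_smul {d : ℕ} (c : ℝ) (Q : Matrix (Fin d) (Fin d) ℝ) (e : Sym2 (Fin d)) :
    edgeWeight (c • Q) e = c * edgeWeight Q e := by
  induction e with
  | _ i j =>
    change (c * Q i j + c * Q j i) / 2 = c * ((Q i j + Q j i) / 2)
    ring

theorem continuous_edgeWeight {d : ℕ} (e : Sym2 (Fin d)) :
    Continuous fun Q : Matrix (Fin d) (Fin d) ℝ => edgeWeight Q e := by
  induction e with
  | _ i j =>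
    change Continuous fun Q : Matrix (Fin d) (Fin d) ℝ => (Q i j + Q j i) / 2
    fun_prop

theorem continuous_treeSum {d : ℕ} :
    Continuous fun Q : Matrix (Fin d) (Fin d) ℝ => treeSum Q :=
  continuous_finsetSum _ fun _ _ => continuous_finsetProd _ fun e _ => continuous_edgeWeight e

theorem card_of_isTree {d : ℕ} {T : Finset (Sym2 (Fin d))}
    (hT : (SimpleGraph.fromEdgeSet (T : Set (Sym2 (Fin d)))).IsTree)
    (hE : (SimpleGraph.fromEdgeSet (T : Set (Sym2 (Fin d)))).edgeSet = T) :
    T.card = d - 1 := by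
  have h := hT.card_edgeFinset
  have hT' : (SimpleGraph.fromEdgeSet (T : Set (Sym2 (Fin d)))).edgeFinset = T := by
    ext e
    rw [SimpleGraph.mem_edgeFinset, hE, Finset.mem_coe]
  rw [hT', Fintype.card_fin] at h
  omega

theorem treeSum_smul {d : ℕ} (c : ℝ) (Q : Matrix (Fin d) (Fin d) ℝ) :
    treeSum (c • Q) = c ^ (d - 1) * treeSum Q := by
  simp only [treeSum, edgeWeight_smul, Finset.mul_sum, Finset.prod_mul_distrib,
    Finset.prod_const]
  refine Finset.sum_congr rfl fun T hT => ?_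
  obtain ⟨hT, hE⟩ := (Finset.mem_filter.mp hT).2
  rw [card_of_isTree hT hE]

theorem edgeFinset_mem_spanningTrees {d : ℕ} {G : SimpleGraph (Fin d)} (hG : G.IsTree) :
    G.edgeFinset ∈ Finset.univ.filter (fun T : Finset (Sym2 (Fin d)) =>
      (SimpleGraph.fromEdgeSet (T : Set (Sym2 (Fin d)))).IsTree ∧
      (SimpleGraph.fromEdgeSet (T : Set (Sym2 (Fin d)))).edgeSet = T) := by
  rw [Finset.mem_filter, SimpleGraph.coe_edgeFinset, SimpleGraph.fromEdgeSet_edgeSet]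
  exact ⟨Finset.mem_univ _, hG, rfl⟩

theorem treeSum_pos_of_isTree {d : ℕ} {Q : Matrix (Fin d) (Fin d) ℝ} (hQ : ∀ i j, 0 ≤ Q i j)
    {G : SimpleGraph (Fin d)} (hG : G.IsTree) (hpos : ∀ e ∈ G.edgeSet, 0 < edgeWeight Q e) :
    0 < treeSum Q :=
  Finset.sum_pos' (fun _ _ => Finset.prod_nonneg fun e _ => edgeWeight_nonneg hQ e)
    ⟨_, edgeFinset_mem_spanningTrees hG,
      Finset.prod_pos fun e he => hpos e (SimpleGraph.mem_edgeFinset.mp he)⟩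

theorem exists_isTree_of_treeSum_pos {d : ℕ} {Q : Matrix (Fin d) (Fin d) ℝ}
    (hQ : ∀ i j, 0 ≤ Q i j) (hpos : 0 < treeSum Q) :
    ∃ G : SimpleGraph (Fin d), G.IsTree ∧ ∀ e ∈ G.edgeSet, 0 < edgeWeight Q e := by
  obtain ⟨T, hT, hne⟩ := Finset.exists_ne_zero_of_sum_ne_zero hpos.ne'
  obtain ⟨hT, hE⟩ := (Finset.mem_filter.mp hT).2
  refine ⟨_, hT, fun e he => (edgeWeight_nonneg hQ e).lt_of_ne' ?_⟩
  rw [hE] at he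
  exact Finset.prod_ne_zero_iff.mp hne e he

theorem isAcyclic_edge {V : Type*} (i j : V) : (SimpleGraph.edge i j).IsAcyclic := by
  rcases eq_or_ne i j with rfl | h
  · simp
  · simpa using SimpleGraph.isAcyclic_bot.sup_edge_of_not_reachable (u := i) (v := j) (by simpa)

/-- Raising the weight of one edge of a connected weighted graph strictly raises the tree sum. -/
theorem treeSum_lt_treeSum {d : ℕ} {Q Q' : Matrix (Fin d) (Fin d) ℝ} (hQ : ∀ i j, 0 ≤ Q i j)
    (hpos : 0 < treeSum Q) (hle : ∀ i j, Q i j ≤ Q' i j) {i j : Fin d} (hij : i ≠ j)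
    (hlt : edgeWeight Q s(i, j) < edgeWeight Q' s(i, j)) : treeSum Q < treeSum Q' := by
  obtain ⟨G, hG, hGpos⟩ := exists_isTree_of_treeSum_pos hQ hpos
  obtain ⟨T, hET, hTG, hT⟩ := (hG.connected.mono le_sup_left).exists_isTree_le_of_le_of_isAcyclic
    (le_sup_right : SimpleGraph.edge i j ≤ G ⊔ SimpleGraph.edge i j) (isAcyclic_edge i j)
  have hmem : s(i, j) ∈ T.edgeFinset := by
    rw [SimpleGraph.mem_edgeFinset, SimpleGraph.mem_edgeSet]
    exact hET (by simp [SimpleGraph.edge_adj, hij])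
  have hTpos : ∀ e ∈ T.edgeFinset, e ≠ s(i, j) → 0 < edgeWeight Q e := by
    intro e he hne
    have := SimpleGraph.edgeSet_mono hTG (SimpleGraph.mem_edgeFinset.mp he)
    rw [SimpleGraph.edgeSet_sup, SimpleGraph.edgeSet_edge_of_ne hij] at this
    exact hGpos e (this.resolve_right hne)
  refine Finset.sum_lt_sum (fun S _ => Finset.prod_le_prod (fun e _ => edgeWeight_nonneg hQ e)
    fun e _ => edgeWeight_mono hle e) ⟨_, edgeFinset_mem_spanningTrees hT, ?_⟩
  rw [← Finset.mul_prod_erase _ _ hmem, ← Finset.mul_prod_erase _ _ hmem]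
  refine mul_lt_mul hlt (Finset.prod_le_prod (fun e _ => edgeWeight_nonneg hQ e)
    fun e _ => edgeWeight_mono hle e) (Finset.prod_pos fun e he => ?_)
    ((edgeWeight_nonneg hQ _).trans hlt.le)
  exact hTpos e (Finset.mem_of_mem_erase he) (Finset.ne_of_mem_erase he)

/-- The linear part `Σ_{i<j} Γ_{ij}·Q_{ij}` of the surrogate log-likelihood. -/
noncomputable def upperPairing {d : ℕ} (Γb Q : Matrix (Fin d) (Fin d) ℝ) : ℝ :=
  ∑ i : Fin d, ∑ j ∈ Finset.univ.filter (fun j => i < j), Γb i j * Q i j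

theorem surrogateLL_eq {d : ℕ} (Γb Q : Matrix (Fin d) (Fin d) ℝ) :
    surrogateLL Γb Q = Real.log (treeSum Q) - upperPairing Γb Q := rfl

theorem upperPairing_smul {d : ℕ} (c : ℝ) (Γb Q : Matrix (Fin d) (Fin d) ℝ) :
    upperPairing Γb (c • Q) = c * upperPairing Γb Q := by
  simp only [upperPairing, Finset.mul_sum, Matrix.smul_apply, smul_eq_mul, mul_left_comm]

theorem continuous_upperPairing {d : ℕ} (Γb : Matrix (Fin d) (Fin d) ℝ) :
    Continuous fun Q : Matrix (Fin d) (Fin d) ℝ => upperPairing Γb Q := by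
  unfold upperPairing
  fun_prop

theorem mul_le_upperPairing {d : ℕ} {Γb Q : Matrix (Fin d) (Fin d) ℝ}
    (hΓ : ∀ i j, 0 ≤ Γb i j) (hQ : ∀ i j, 0 ≤ Q i j) {i j : Fin d} (hij : i < j) :
    Γb i j * Q i j ≤ upperPairing Γb Q := by
  have h (a b : Fin d) : 0 ≤ Γb a b * Q a b := mul_nonneg (hΓ a b) (hQ a b)
  exact (Finset.single_le_sum (f := fun j => Γb i j * Q i j) (fun b _ => h i b)
    (Finset.mem_filter.mpr ⟨Finset.mem_univ j, hij⟩)).trans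
    (Finset.single_le_sum (f := fun i => ∑ j ∈ Finset.univ.filter (fun j => i < j), Γb i j * Q i j)
      (fun a _ => Finset.sum_nonneg fun b _ => h a b) (Finset.mem_univ i))

/-- At a maximiser every upper-triangular coefficient is positive: otherwise raising that entry
of `Q` would strictly increase the likelihood. -/
theorem pos_of_isMax_surrogateLL {d : ℕ} {Γb Q : Matrix (Fin d) (Fin d) ℝ}
    (hsymm : Q.IsSymm) (hzero : ∀ i, Q i i = 0) (hQ : ∀ i j, 0 ≤ Q i j) (hpos : 0 < treeSum Q)
    (hmax : ∀ Q' : Matrix (Fin d) (Fin d) ℝ, Q'.IsSymm → (∀ i, Q' i i = 0) →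
      (∀ i j, i ≠ j → 0 ≤ Q' i j) → 0 < treeSum Q' → surrogateLL Γb Q' ≤ surrogateLL Γb Q)
    {i j : Fin d} (hij : i < j) : 0 < Γb i j := by
  by_contra! hΓ
  let Q' : Matrix (Fin d) (Fin d) ℝ :=
    fun a b => if s(a, b) = s(i, j) then Q a b + 1 else Q a b
  have hle (a b : Fin d) : Q a b ≤ Q' a b := by
    simp only [Q']
    split_ifs <;> linarith
  have hsymm' : Q'.IsSymm := by
    refine Matrix.IsSymm.ext fun a b => ?_
    simp only [Q', Sym2.eq_swap (a := b) (b := a), hsymm.apply a b]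
  have hzero' (a : Fin d) : Q' a a = 0 := by
    have : s(a, a) ≠ s(i, j) := by
      intro h
      rcases Sym2.eq_iff.mp h with ⟨rfl, rfl⟩ | ⟨rfl, rfl⟩ <;> exact lt_irrefl _ hij
    simp only [Q', if_neg this, hzero]
  have htree : treeSum Q < treeSum Q' := by
    refine treeSum_lt_treeSum hQ hpos hle hij.ne ?_
    rw [edgeWeight_mk hsymm, edgeWeight_mk hsymm']
    simp [Q']
  have hpair : upperPairing Γb Q' ≤ upperPairing Γb Q := by
    refine Finset.sum_le_sum fun a _ => Finset.sum_le_sum fun b hb => ?_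
    have hab : a < b := (Finset.mem_filter.mp hb).2
    by_cases h : s(a, b) = s(i, j)
    · rcases Sym2.eq_iff.mp h with ⟨rfl, rfl⟩ | ⟨rfl, rfl⟩
      · exact mul_le_mul_of_nonpos_left (hle a b) hΓ
      · exact absurd hab hij.asymm
    · simp only [Q', if_neg h, le_refl]
  have hlog := Real.log_lt_log hpos htree
  have := hmax Q' hsymm' hzero' (fun a b _ => (hQ a b).trans (hle a b)) (hpos.trans htree)
  rw [surrogateLL_eq, surrogateLL_eq] at this
  linarith

theorem nonneg_of_pos_of_lt {d : ℕ} {Γb : Matrix (Fin d) (Fin d) ℝ} (hsym : Γb.IsSymm)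
    (hdiag : ∀ i, Γb i i = 0) (hΓ : ∀ i j, i < j → 0 < Γb i j) (i j : Fin d) : 0 ≤ Γb i j := by
  rcases lt_trichotomy i j with h | rfl | h
  · exact (hΓ i j h).le
  · exact (hdiag i).ge
  · exact (hsym.apply i j).symm ▸ (hΓ j i h).le

/-- The set of symmetric, zero-diagonal, nonnegative matrices on which the linear part of the
likelihood equals `1`. -/
def weightSlice {d : ℕ} (Γb : Matrix (Fin d) (Fin d) ℝ) : Set (Matrix (Fin d) (Fin d) ℝ) :=
  {Q | Q.IsSymm ∧ (∀ i, Q i i = 0) ∧ (∀ i j, 0 ≤ Q i j) ∧ upperPairing Γb Q = 1}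

theorem isCompact_weightSlice {d : ℕ} {Γb : Matrix (Fin d) (Fin d) ℝ} (hsym : Γb.IsSymm)
    (hdiag : ∀ i, Γb i i = 0) (hΓ : ∀ i j, i < j → 0 < Γb i j) :
    IsCompact (weightSlice Γb) := by
  have hΓ0 := nonneg_of_pos_of_lt hsym hdiag hΓ
  have hbox : IsCompact (Set.univ.pi fun i => Set.univ.pi fun j => Set.Icc 0 (Γb i j)⁻¹ :
      Set (Matrix (Fin d) (Fin d) ℝ)) :=
    isCompact_univ_pi fun i => isCompact_univ_pi fun j => isCompact_Icc
  refine hbox.of_isClosed_subset ?_ ?_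
  · have hentry (i j : Fin d) : Continuous fun Q : Matrix (Fin d) (Fin d) ℝ => Q i j := by
      fun_prop
    have h1 : IsClosed {Q : Matrix (Fin d) (Fin d) ℝ | Q.IsSymm} :=
      isClosed_eq (by fun_prop) continuous_id
    have h2 : IsClosed {Q : Matrix (Fin d) (Fin d) ℝ | ∀ i, Q i i = 0} := by
      simp only [Set.ofPred_forall]
      exact isClosed_iInter fun i => isClosed_eq (hentry i i) continuous_const
    have h3 : IsClosed {Q : Matrix (Fin d) (Fin d) ℝ | ∀ i j, 0 ≤ Q i j} := by
      simp only [Set.ofPred_forall]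
      exact isClosed_iInter fun i => isClosed_iInter fun j =>
        isClosed_le continuous_const (hentry i j)
    exact h1.inter (h2.inter (h3.inter
      (isClosed_eq (continuous_upperPairing Γb) continuous_const)))
  · rintro Q ⟨hsymm, hzero, hQ, hone⟩ i - j -
    have hupper {a b : Fin d} (hab : a < b) : Q a b ≤ (Γb a b)⁻¹ := by
      rw [← one_div, le_div_iff₀' (hΓ a b hab)]
      exact (mul_le_upperPairing hΓ0 hQ hab).trans_eq hone
    refine ⟨hQ i j, ?_⟩
    rcases lt_trichotomy i j with h | rfl | h
    · exact hupper h
    · rw [hzero, hdiag, _root_.inv_zero]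
    · rw [← hsymm.apply i j, ← hsym.apply i j]
      exact hupper h

theorem upperPairing_pos {d : ℕ} (hd : 2 ≤ d) {Γb Q : Matrix (Fin d) (Fin d) ℝ}
    (hΓ0 : ∀ i j, 0 ≤ Γb i j) (hΓ : ∀ i j, i < j → 0 < Γb i j) (hsymm : Q.IsSymm)
    (hzero : ∀ i, Q i i = 0) (hQ : ∀ i j, 0 ≤ Q i j) (hpos : 0 < treeSum Q) :
    0 < upperPairing Γb Q := by
  by_contra! hle
  have hupper {a b : Fin d} (hab : a < b) : Q a b = 0 := by
    refine le_antisymm ?_ (hQ a b)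
    exact nonpos_of_mul_nonpos_right ((mul_le_upperPairing hΓ0 hQ hab).trans hle) (hΓ a b hab)
  have hQ0 : Q = (0 : ℝ) • Q := by
    ext i j
    rw [zero_smul, Matrix.zero_apply]
    rcases lt_trichotomy i j with h | rfl | h
    · exact hupper h
    · exact hzero i
    · rw [← hsymm.apply i j]
      exact hupper h
  rw [hQ0, treeSum_smul, zero_pow (by omega), zero_mul] at hpos
  exact lt_irrefl _ hpos

theorem inv_smul_mem_weightSlice {d : ℕ} {Γb Q : Matrix (Fin d) (Fin d) ℝ} (hsymm : Q.IsSymm)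
    (hzero : ∀ i, Q i i = 0) (hQ : ∀ i j, 0 ≤ Q i j) (hpos : 0 < upperPairing Γb Q) :
    (upperPairing Γb Q)⁻¹ • Q ∈ weightSlice Γb := by
  refine ⟨hsymm.smul _, fun i => ?_, fun i j => ?_, ?_⟩
  · rw [Matrix.smul_apply, hzero, smul_zero]
  · exact mul_nonneg (inv_nonneg.mpr hpos.le) (hQ i j)
  · rw [upperPairing_smul, inv_mul_cancel₀ hpos.ne']

/-- Unit weights on the complete graph have positive tree sum. -/
theorem treeSum_unitWeights_pos {d : ℕ} (hd : 2 ≤ d) :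
    0 < treeSum (fun i j : Fin d => if i = j then (0 : ℝ) else 1) := by
  have : Nonempty (Fin d) := ⟨⟨0, by omega⟩⟩
  obtain ⟨T, -, hT⟩ := (SimpleGraph.connected_top (V := Fin d)).exists_isTree_le
  refine treeSum_pos_of_isTree (fun i j => by split_ifs <;> norm_num) hT fun e he => ?_
  induction e with
  | _ i j =>
    have hne : i ≠ j := SimpleGraph.Adj.ne he
    simp [edgeWeight, hne, hne.symm]

/-- On each ray the likelihood is maximised where its linear part equals `n`. -/
theorem mul_log_sub_le {n s : ℝ} (hn : 0 < n) (hs : 0 < s) :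
    n * Real.log s - s ≤ n * Real.log n - n := by
  have h := mul_le_mul_of_nonneg_left (Real.log_le_sub_one_of_pos (div_pos hs hn)) hn.le
  rw [Real.log_div hs.ne' hn.ne', mul_sub, mul_sub, mul_div_cancel₀ _ hn.ne'] at h
  linarith

theorem exists_isMax_surrogateLL {d : ℕ} (hd : 2 ≤ d) {Γb : Matrix (Fin d) (Fin d) ℝ}
    (hsym : Γb.IsSymm) (hdiag : ∀ i, Γb i i = 0) (hΓ : ∀ i j, i < j → 0 < Γb i j) :
    ∃ Q : Matrix (Fin d) (Fin d) ℝ,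
      (Q.IsSymm ∧ (∀ i, Q i i = 0) ∧ (∀ i j, 0 ≤ Q i j) ∧ 0 < treeSum Q) ∧
      ∀ Q' : Matrix (Fin d) (Fin d) ℝ, Q'.IsSymm → (∀ i, Q' i i = 0) → (∀ i j, 0 ≤ Q' i j) →
        0 < treeSum Q' → surrogateLL Γb Q' ≤ surrogateLL Γb Q := by
  have hΓ0 := nonneg_of_pos_of_lt hsym hdiag hΓ
  have hray {Q : Matrix (Fin d) (Fin d) ℝ} (hsymm : Q.IsSymm) (hzero : ∀ i, Q i i = 0)
      (hQ : ∀ i j, 0 ≤ Q i j) (hpos : 0 < treeSum Q) :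
      ∃ s : ℝ, 0 < s ∧ ∃ P ∈ weightSlice Γb, 0 < treeSum P ∧ Q = s • P := by
    have hs := upperPairing_pos hd hΓ0 hΓ hsymm hzero hQ hpos
    refine ⟨_, hs, _, inv_smul_mem_weightSlice hsymm hzero hQ hs, ?_, ?_⟩
    · rw [treeSum_smul]
      positivity
    · rw [smul_smul, mul_inv_cancel₀ hs.ne', one_smul]
  have hLL {s : ℝ} (hs : 0 < s) {P : Matrix (Fin d) (Fin d) ℝ} (hP : P ∈ weightSlice Γb)
      (hpos : 0 < treeSum P) : surrogateLL Γb (s • P) =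
        Real.log (treeSum P) + (((d - 1 : ℕ) : ℝ) * Real.log s - s) := by
    rw [surrogateLL_eq, treeSum_smul, upperPairing_smul, hP.2.2.2,
      Real.log_mul (pow_pos hs _).ne' hpos.ne', Real.log_pow]
    ring
  obtain ⟨-, -, P₁, hP₁, hP₁pos, -⟩ := hray
    (Matrix.IsSymm.ext fun i j => by simp only [eq_comm]) (fun i => if_pos rfl)
    (fun i j => by split_ifs <;> norm_num) (treeSum_unitWeights_pos hd)
  obtain ⟨P, hP, hPmax⟩ := (isCompact_weightSlice hsym hdiag hΓ).exists_isMaxOn ⟨P₁, hP₁⟩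
    continuous_treeSum.continuousOn
  have hPpos : 0 < treeSum P := hP₁pos.trans_le (hPmax hP₁)
  have hn : (0 : ℝ) < ((d - 1 : ℕ) : ℝ) := by
    exact_mod_cast (by omega : 0 < d - 1)
  refine ⟨((d - 1 : ℕ) : ℝ) • P, ⟨hP.1.smul _, fun i => ?_, fun i j => ?_, ?_⟩, ?_⟩
  · rw [Matrix.smul_apply, hP.2.1, smul_zero]
  · exact mul_nonneg hn.le (hP.2.2.1 i j)
  · rw [treeSum_smul]
    positivity
  · intro Q' hsymm hzero hQ' hpos
    obtain ⟨s, hs, R, hR, hRpos, rfl⟩ := hray hsymm hzero hQ' hpos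
    rw [hLL hs hR hRpos, hLL hn hP hPpos]
    exact add_le_add (Real.log_le_log hRpos (hPmax hR)) (mul_log_sub_le hn hs)

/-- Let `d ≥ 2` and `Γ̄` symmetric with zero diagonal. The supremum of
`ℓ(Q) = log τ(Q) − Σ_{i<j} Γ̄_{ij} Q_{ij}` over all symmetric zero-diagonal `Q` with
nonnegative entries and `τ(Q) > 0` is attained at some such `Q` if and only if
`Γ̄_{ij} > 0` for all `i < j`. -/
theorem surrogate_optimum_exists_iff (d : ℕ) (hd : 2 ≤ d)
    (Γb : Matrix (Fin d) (Fin d) ℝ) (hsym : Γb.IsSymm) (hdiag : ∀ i, Γb i i = 0) :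
    (∃ Q : Matrix (Fin d) (Fin d) ℝ,
        (Q.IsSymm ∧ (∀ i, Q i i = 0) ∧ (∀ i j, i ≠ j → 0 ≤ Q i j) ∧ 0 < treeSum Q) ∧
        (∀ Q' : Matrix (Fin d) (Fin d) ℝ,
          Q'.IsSymm → (∀ i, Q' i i = 0) → (∀ i j, i ≠ j → 0 ≤ Q' i j) → 0 < treeSum Q' →
            surrogateLL Γb Q' ≤ surrogateLL Γb Q)) ↔
      (∀ i j : Fin d, i < j → 0 < Γb i j) := by
  have hnonneg {Q : Matrix (Fin d) (Fin d) ℝ} (hzero : ∀ i, Q i i = 0)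
      (hoff : ∀ i j, i ≠ j → 0 ≤ Q i j) (i j : Fin d) : 0 ≤ Q i j := by
    rcases eq_or_ne i j with rfl | h
    · exact (hzero i).ge
    · exact hoff i j h
  constructor
  · rintro ⟨Q, ⟨hsymm, hzero, hoff, hpos⟩, hmax⟩ i j hij
    exact pos_of_isMax_surrogateLL hsymm hzero (hnonneg hzero hoff) hpos hmax hij
  · intro hΓ
    obtain ⟨Q, ⟨hsymm, hzero, hQ, hpos⟩, hmax⟩ := exists_isMax_surrogateLL hd hsym hdiag hΓ
    exact ⟨Q, ⟨hsymm, hzero, fun i j _ => hQ i j, hpos⟩, fun Q' hsymm' hzero' hoff' =>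
      hmax Q' hsymm' hzero' (hnonneg hzero' hoff')⟩
end
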